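/- arXiv:2403.03110 — 3 statements merged into one kernel-verified Lean document; each statement's English description precedes it below -/
import Mathlib

section
/- Let X be a zero-dimensional compact metric space, let I be a σ-ideal on X, and let 𝒦 be the collection of all compact sets belonging to I. Assume that I is not generated by 𝒦, i.e., there is a set in I which is not contained in any F_σ set belonging to I. Then there exists a nonempty G_δ set G ⊆ X with G ∈ I such that no nonempty relatively open subset of G is contained in an F_σ set belonging to I; consequently, for every such G, every Lusin set T in G satisfies |T ∩ K| ≤ ℵ₀ for every K ∈ 𝒦. -/
open Cardinal

open Set in
theorem sol_child {X Z : Type} [MetricSpace X] [CompactSpace X] [MetricSpace Z] (f : Z → X)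
    (hf : Continuous f) (V : Set Z) (hV : IsOpen V) (U : Set X) (hU : IsOpen U)
    (hVU : ∀ z ∈ V, f z ∈ U) (L : Set X) (hLc : IsClosed L) (hL : L ⊆ closure (f '' V \ L))
    (hne : L.Nonempty) (ε : ℝ) (hε : 0 < ε) :
    ∃ (V' : ℕ → Set Z) (U' : ℕ → Set X), (∀ n, IsOpen (V' n) ∧ (V' n).Nonempty ∧ IsOpen (U' n) ∧
      (∀ z ∈ V' n, f z ∈ U' n) ∧ (∀ a ∈ V' n, ∀ b ∈ V' n, dist a b < ε) ∧
      (∀ a ∈ U' n, ∀ b ∈ U' n, dist a b < ε) ∧ closure (U' n) ⊆ U ∧ V' n ⊆ V) ∧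
      (∀ m n, m ≠ n → Disjoint (U' m) (U' n)) ∧
      ∀ y : ℕ → X, (∀ n, y n ∈ U' n) → L ⊆ closure (range y) := by
  have : Nonempty L := hne.to_subtype
  obtain ⟨u, hu⟩ := TopologicalSpace.exists_dense_seq L
  set e : ℕ → X := fun n => (u (Nat.unpair n).1 : X) with he
  have step : ∀ n : ℕ, ∀ δ : ℝ, ∃ z, 0 < δ → z ∈ V ∧ f z ∉ L ∧ dist (f z) (e n) < δ := by
    intro n δ
    by_cases hδ : 0 < δ
    · have h1 := hL (u (Nat.unpair n).1).2
      rw [Metric.mem_closure_iff] at h1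
      obtain ⟨b, ⟨⟨z, hz, rfl⟩, hb⟩, hd⟩ := h1 δ hδ
      exact ⟨z, fun _ => ⟨hz, hb, by rw [dist_comm]; exact hd⟩⟩
    · have h1 := hL (u (Nat.unpair n).1).2
      rw [Metric.mem_closure_iff] at h1
      obtain ⟨b, ⟨⟨z, hz, rfl⟩, hb⟩, hd⟩ := h1 1 one_pos
      exact ⟨z, fun h => absurd h hδ⟩
  choose zf hzf using step
  let δ : ℕ → ℝ := fun n => Nat.rec (1:ℝ)
    (fun n d => min (1 / ((n:ℝ) + 2)) (Metric.infDist (f (zf n d)) L / 2)) n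
  have hδs : ∀ n, δ (n+1) = min (1 / ((n:ℝ) + 2)) (Metric.infDist (f (zf n (δ n))) L / 2) :=
    fun n => rfl
  have hpos : ∀ x, x ∉ L → 0 < Metric.infDist x L := fun x hx =>
    (hLc.notMem_iff_infDist_pos hne).1 hx
  have hδ : ∀ n, 0 < δ n := by
    intro n
    induction n with
    | zero => exact one_pos
    | succ n ih =>
      rw [hδs]
      have := hpos _ (hzf n _ ih).2.1
      positivity
  set z : ℕ → Z := fun n => zf n (δ n) with hz
  have hzV : ∀ n, z n ∈ V := fun n => (hzf n _ (hδ n)).1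
  set r : ℕ → ℝ := fun n => Metric.infDist (f (z n)) L with hr
  have hrpos : ∀ n, 0 < r n := fun n => hpos _ (hzf n _ (hδ n)).2.1
  have hze : ∀ n, dist (f (z n)) (e n) < δ n := fun n => (hzf n _ (hδ n)).2.2
  have hrδ : ∀ n, r n < δ n := fun n =>
    (Metric.infDist_le_dist_of_mem (u (Nat.unpair n).1).2).trans_lt (hze n)
  have hrs : ∀ n, r (n+1) < r n / 2 := fun n =>
    (hrδ (n+1)).trans_le (by rw [hδs]; exact min_le_right _ _)
  have hanti : StrictAnti r := strictAnti_nat_of_succ_lt fun n => by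
    have := hrs n; have := hrpos n; linarith
  have hlt : ∀ m n, m < n → r n < r m / 2 := fun m n h =>
    (hanti.antitone (Nat.succ_le_of_lt h)).trans_lt (hrs m)
  have hδ' : ∀ n, δ n ≤ 1 / ((n:ℝ) + 1) := by
    intro n
    cases n with
    | zero => simp [δ]
    | succ n => rw [hδs]; push_cast; refine (min_le_left _ _).trans (le_of_eq ?_); ring
  have hρ : ∀ n, ∃ ρ > 0, ρ ≤ r n / 3 ∧ ρ ≤ ε / 3 ∧ Metric.closedBall (f (z n)) ρ ⊆ U := by
    intro n
    obtain ⟨ρ, h0, h1⟩ := Metric.nhds_basis_closedBall.mem_iff.1 (hU.mem_nhds (hVU _ (hzV n)))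
    refine ⟨min ρ (min (r n / 3) (ε / 3)), ?_, ?_, ?_, ?_⟩
    · have := hrpos n; positivity
    · exact (min_le_right _ _).trans (min_le_left _ _)
    · exact (min_le_right _ _).trans (min_le_right _ _)
    · exact (Metric.closedBall_subset_closedBall (min_le_left _ _)).trans h1
  choose ρ hρ0 hρr hρε hρU using hρ
  have hdisj : ∀ m n, m < n →
      Disjoint (Metric.ball (f (z m)) (ρ m)) (Metric.ball (f (z n)) (ρ n)) := by
    intro m n hmn
    rw [Set.disjoint_left]
    intro x hxm hxn
    rw [Metric.mem_ball] at hxm hxn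
    have h1 := hlt m n hmn
    have h2 : r m ≤ Metric.infDist x L + dist (f (z m)) x := Metric.infDist_le_infDist_add_dist
    have h3 : Metric.infDist x L ≤ r n + dist x (f (z n)) := Metric.infDist_le_infDist_add_dist
    rw [dist_comm] at h2
    have := hρr m; have := hρr n
    linarith
  refine ⟨fun n => V ∩ f ⁻¹' (Metric.ball (f (z n)) (ρ n)) ∩ Metric.ball (z n) (ε / 3),
    fun n => Metric.ball (f (z n)) (ρ n), fun n => ⟨?_, ?_, ?_, ?_, ?_, ?_, ?_, ?_⟩, ?_, ?_⟩
  · exact (hV.inter (Metric.isOpen_ball.preimage hf)).inter Metric.isOpen_ball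
  · refine ⟨z n, ⟨hzV n, ?_⟩, ?_⟩
    · simpa using hρ0 n
    · simpa using hε
  · exact Metric.isOpen_ball
  · exact fun z hz => hz.1.2
  · intro a ha b hb
    have h1 := ha.2; have h2 := hb.2
    rw [Metric.mem_ball] at h1 h2
    have := dist_triangle_right a b (z n)
    linarith
  · intro a h1 b h2
    rw [Metric.mem_ball] at h1 h2
    have := dist_triangle_right a b (f (z n))
    have := hρε n
    linarith
  · exact Metric.closure_ball_subset_closedBall.trans (hρU n)
  · exact fun z hz => hz.1.1
  · intro m n hmn
    rcases lt_or_gt_of_ne hmn with h | h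
    · exact hdisj m n h
    · exact (hdisj n m h).symm
  · intro y hy
    have key : ∀ k, (u k : X) ∈ closure (range y) := by
      intro k
      rw [Metric.mem_closure_iff]
      intro η hη
      obtain ⟨N, hN⟩ := exists_nat_one_div_lt (show (0:ℝ) < η / 2 by linarith)
      refine ⟨y (Nat.pair k N), mem_range_self _, ?_⟩
      set n := Nat.pair k N with hn
      have hen : e n = u k := by simp [he, hn]
      have hNn : (N:ℝ) ≤ n := by exact_mod_cast Nat.right_le_pair k N
      have h1 := hze n
      have h2 := hδ' n
      have h3 := hy n
      have h4 := hρr n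
      have h5 := hrδ n
      have h6 : 1 / ((n:ℝ) + 1) ≤ 1 / ((N:ℝ) + 1) := by gcongr
      rw [Metric.mem_ball] at h3
      rw [← hen, dist_comm]
      have := dist_triangle (y n) (f (z n)) (e n)
      have := hrpos n
      linarith
    intro x hx
    have h1 : (⟨x, hx⟩ : L) ∈ closure (range u) := hu _
    have h2 := image_closure_subset_closure_image (f := (Subtype.val : L → X))
      continuous_subtype_val (mem_image_of_mem _ h1)
    refine closure_minimal ?_ isClosed_closure h2
    rintro _ ⟨_, ⟨k, rfl⟩, rfl⟩
    exact key k

open Set in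
theorem sol_case2 {X Z : Type} [MetricSpace X] [CompactSpace X] [MetricSpace Z] [CompleteSpace Z]
    [Nonempty Z] (f : Z → X) (hf : Continuous f) (I : Set (Set X))
    (hI : ∀ s ∈ I, ∀ t ⊆ s, IsClosed t → t ∈ I)
    (h : ∀ V : Set Z, IsOpen V → V.Nonempty → ∃ L : Set X, IsClosed L ∧ L.Nonempty ∧ L ∉ I ∧
      L ⊆ closure (f '' V \ L)) :
    ∃ G : Set X, G.Nonempty ∧ IsGδ G ∧ G ⊆ range f ∧
      ∀ U : Set X, IsOpen U → (U ∩ G).Nonempty → closure (U ∩ G) ∉ I := by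
  let N := {p : Set Z × Set X // IsOpen p.1 ∧ p.1.Nonempty ∧ IsOpen p.2 ∧ ∀ z ∈ p.1, f z ∈ p.2}
  have hchild : ∀ (p : N) (k : ℕ), ∃ c : ℕ → N,
      (∀ n, (∀ a ∈ (c n).1.1, ∀ b ∈ (c n).1.1, dist a b < 1 / ((k:ℝ) + 1)) ∧
        (∀ a ∈ (c n).1.2, ∀ b ∈ (c n).1.2, dist a b < 1 / ((k:ℝ) + 1)) ∧
        closure (c n).1.2 ⊆ p.1.2 ∧ (c n).1.1 ⊆ p.1.1) ∧
      (∀ m n, m ≠ n → Disjoint (c m).1.2 (c n).1.2) ∧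
      ∀ y : ℕ → X, (∀ n, y n ∈ (c n).1.2) → closure (range y) ∉ I := by
    rintro ⟨⟨V, U⟩, hV, hVn, hU, hVU⟩ k
    obtain ⟨L, hLc, hLn, hLI, hL⟩ := h V hV hVn
    obtain ⟨V', U', h1, h2, h3⟩ := sol_child f hf V hV U hU hVU L hLc hL hLn (1 / ((k:ℝ) + 1))
      (by positivity)
    refine ⟨fun n => ⟨(V' n, U' n), (h1 n).1, (h1 n).2.1, (h1 n).2.2.1, (h1 n).2.2.2.1⟩,
      fun n => (h1 n).2.2.2.2, h2, fun y hy hmem => hLI (hI _ hmem _ (h3 y hy) hLc)⟩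
  choose c hc hcd hcI using hchild
  let root : N := ⟨(univ, univ), isOpen_univ, univ_nonempty, isOpen_univ, fun _ _ => mem_univ _⟩
  let node : List ℕ → N := fun s => List.rec root (fun n s p => c p s.length n) s
  have hnode : ∀ n s, node (n :: s) = c (node s) s.length n := fun n s => rfl
  let U : List ℕ → Set X := fun s => (node s).1.2
  let V : List ℕ → Set Z := fun s => (node s).1.1
  have hUo : ∀ s, IsOpen (U s) := fun s => (node s).2.2.2.1
  have hVn : ∀ s, (V s).Nonempty := fun s => (node s).2.2.1
  have hVU : ∀ s, ∀ z ∈ V s, f z ∈ U s := fun s => (node s).2.2.2.2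
  have hUn : ∀ s, (U s).Nonempty := fun s => (hVn s).elim fun z hz => ⟨f z, hVU s z hz⟩
  have hVd : ∀ n s, ∀ a ∈ V (n :: s), ∀ b ∈ V (n :: s), dist a b < 1 / ((s.length : ℝ) + 1) :=
    fun n s => (hc (node s) s.length n).1
  have hUd : ∀ n s, ∀ a ∈ U (n :: s), ∀ b ∈ U (n :: s), dist a b < 1 / ((s.length : ℝ) + 1) :=
    fun n s => (hc (node s) s.length n).2.1
  have hUc : ∀ n s, closure (U (n :: s)) ⊆ U s := fun n s => (hc (node s) s.length n).2.2.1
  have hUs : ∀ n s, U (n :: s) ⊆ U s := fun n s => subset_closure.trans (hUc n s)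
  have hUdisj : ∀ s m n, m ≠ n → Disjoint (U (m :: s)) (U (n :: s)) :=
    fun s => hcd (node s) s.length
  have hUI : ∀ s (y : ℕ → X), (∀ n, y n ∈ U (n :: s)) → closure (range y) ∉ I :=
    fun s => hcI (node s) s.length
  have hVs : ∀ n s, V (n :: s) ⊆ V s := fun n s => (hc (node s) s.length n).2.2.2
  have huniq : ∀ s t : List ℕ, s.length = t.length → ∀ x, x ∈ U s → x ∈ U t → s = t := by
    intro s
    induction s with
    | nil =>
      intro t ht x _ _
      exact (List.length_eq_zero_iff.1 ht.symm).symm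
    | cons m s ih =>
      intro t ht x hxs hxt
      cases t with
      | nil => simp at ht
      | cons n t =>
        have hst : s = t := ih t (by simpa using ht) x (hUs _ _ hxs) (hUs _ _ hxt)
        subst hst
        by_contra hne
        have hmn : m ≠ n := fun hmn => hne (by rw [hmn])
        exact Set.disjoint_left.1 (hUdisj s m n hmn) hxs hxt
  have htail : ∀ k s x, k ≤ s.length → x ∈ U s → ∃ t, t.length = k ∧ x ∈ U t := by
    intro k s
    induction s with
    | nil => intro x hk hx; exact ⟨[], by simp at hk; simp [hk], hx⟩
    | cons n s ih =>
      intro x hk hx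
      rcases Nat.lt_or_ge s.length k with h' | h'
      · exact ⟨n :: s, by simp at hk ⊢; omega, hx⟩
      · exact ih x h' (hUs _ _ hx)
  let G : Set X := ⋂ k : ℕ, ⋃ s : {s : List ℕ // s.length = k}, U s.1
  have hG : ∀ x, x ∈ G ↔ ∀ k : ℕ, ∃ s : List ℕ, s.length = k ∧ x ∈ U s := by
    intro x; simp [G]
  have hmeet : ∀ s, (U s ∩ G).Nonempty := by
    intro s
    let b : ℕ → List ℕ := fun j => Nat.rec s (fun _ t => 0 :: t) j
    have hb : ∀ j, b (j+1) = 0 :: b j := fun j => rfl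
    have hbl : ∀ j, j ≤ (b j).length := by
      intro j
      induction j with
      | zero => exact Nat.zero_le _
      | succ j ih => rw [hb]; simpa using ih
    have hne := IsCompact.nonempty_iInter_of_sequence_nonempty_isCompact_isClosed
      (fun j => closure (U (b j)))
      (fun j => closure_mono (by rw [hb]; exact hUs _ _)) (fun j => (hUn _).closure)
      isClosed_closure.isCompact (fun j => isClosed_closure)
    obtain ⟨x, hx⟩ := hne
    rw [mem_iInter] at hx
    have hx' : ∀ j, x ∈ U (b j) := fun j => hUc 0 _ (by rw [← hb]; exact hx (j+1))
    refine ⟨x, hx' 0, (hG x).2 fun k => ?_⟩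
    exact htail k (b k) x (hbl k) (hx' k)
  refine ⟨G, ?_, ?_, ?_, ?_⟩
  · exact (hmeet []).mono inter_subset_right
  · exact IsGδ.iInter_of_isOpen fun k => isOpen_iUnion fun s => hUo _
  · intro x hx
    rw [hG] at hx
    choose s hsl hxs using hx
    have hs : ∀ k, ∃ n, s (k+1) = n :: s k := by
      intro k
      cases hk : s (k+1) with
      | nil => have := hsl (k+1); rw [hk] at this; simp at this
      | cons n t =>
        refine ⟨n, ?_⟩
        have h1 := hxs (k+1)
        have h2 := hsl (k+1)
        rw [hk] at h1 h2
        rw [huniq t (s k) (by rw [hsl]; simpa using h2) x (hUs _ _ h1) (hxs k)]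
    have hVanti : Antitone fun k => V (s k) := antitone_nat_of_succ_le fun k => by
      obtain ⟨n, hn⟩ := hs k
      rw [hn]; exact hVs n _
    choose p hp using fun k => hVn (s (k+1))
    have htend : Filter.Tendsto (fun k : ℕ => 1 / ((k:ℝ) + 1)) Filter.atTop (nhds 0) :=
      tendsto_one_div_add_atTop_nhds_zero_nat
    have hcau : CauchySeq p := by
      refine cauchySeq_of_le_tendsto_0 (fun k : ℕ => 1 / ((k:ℝ) + 1)) ?_ htend
      intro i j k hi hj
      have h1 : p i ∈ V (s (k+1)) := hVanti (Nat.succ_le_succ hi) (hp i)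
      have h2 : p j ∈ V (s (k+1)) := hVanti (Nat.succ_le_succ hj) (hp j)
      obtain ⟨n, hn⟩ := hs k
      rw [hn] at h1 h2
      have := hVd n (s k) _ h1 _ h2
      rw [hsl] at this
      exact this.le
    obtain ⟨q, hq⟩ := cauchySeq_tendsto_of_complete hcau
    refine ⟨q, ?_⟩
    refine tendsto_nhds_unique ((hf.tendsto q).comp hq) ?_
    rw [tendsto_iff_dist_tendsto_zero]
    refine squeeze_zero (fun _ => dist_nonneg) (fun k => ?_) htend
    have h1 := hVU _ _ (hp k)
    have h2 := hxs (k+1)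
    obtain ⟨n, hn⟩ := hs k
    rw [hn] at h1 h2
    have := hUd n (s k) _ h1 _ h2
    rw [hsl] at this
    exact this.le
  · intro W hW ⟨x, hxW, hx⟩ hmem
    obtain ⟨η, hη, hball⟩ := Metric.isOpen_iff.1 hW x hxW
    obtain ⟨k, hk⟩ := exists_nat_one_div_lt hη
    obtain ⟨s, hsl, hxs⟩ := (hG x).1 hx (k+1)
    cases s with
    | nil => simp at hsl
    | cons n t =>
      have htl : t.length = k := by simpa using hsl
      have hsub : U (n :: t) ⊆ W := by
        intro y hy
        apply hball
        rw [Metric.mem_ball]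
        refine (hUd n t y hy x hxs).trans ?_
        rw [htl]; exact hk
      choose y hy using fun m => hmeet (m :: n :: t)
      refine hUI (n :: t) y (fun m => (hy m).1) (hI _ hmem _ (closure_mono ?_) isClosed_closure)
      rintro _ ⟨m, rfl⟩
      exact ⟨hsub (hUs m (n :: t) (hy m).1), (hy m).2⟩

def SolCov {X : Type} [TopologicalSpace X] (I : Set (Set X)) (S : Set X) : Prop :=
  ∃ T : Set (Set X), T.Countable ∧ (∀ t ∈ T, IsClosed t ∧ t ∈ I) ∧ S ⊆ ⋃₀ T

open Set in
theorem sol_baire {X : Type} [MetricSpace X] [CompactSpace X] (I : Set (Set X))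
    (hI : ∀ s ∈ I, ∀ t ⊆ s, IsClosed t → t ∈ I) (G : Set X) (hG : IsGδ G)
    (h : ∀ U : Set X, IsOpen U → (U ∩ G).Nonempty → closure (U ∩ G) ∉ I)
    (U : Set X) (hU : IsOpen U) (hne : (U ∩ G).Nonempty) : ¬ SolCov I (U ∩ G) := by
  rintro ⟨T, hT, hTI, hsub⟩
  have : BaireSpace ↥(U ∩ G) := (hU.isGδ.inter hG).baireSpace_of_t2Space_locallyCompactSpace
  have : Nonempty ↥(U ∩ G) := hne.to_subtype
  have : Countable T := hT.to_subtype
  obtain ⟨⟨t, ht⟩, ⟨x, hx⟩⟩ := nonempty_interior_of_iUnion_of_closed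
    (f := fun t : T => (Subtype.val : ↥(U ∩ G) → X) ⁻¹' t.1)
    (fun t => (hTI t.1 t.2).1.preimage continuous_subtype_val)
    (by
      rw [eq_univ_iff_forall]
      intro x
      obtain ⟨t, ht, hxt⟩ := hsub x.2
      exact mem_iUnion.2 ⟨⟨t, ht⟩, hxt⟩)
  obtain ⟨w, hw, hwo, hxw⟩ := mem_interior.1 hx
  obtain ⟨O, hO, rfl⟩ := isOpen_induced_iff.1 hwo
  refine h (O ∩ U) (hO.inter hU) ⟨x, ⟨hxw, x.2.1⟩, x.2.2⟩
    (hI t (hTI t ht).2 _ (closure_minimal ?_ (hTI t ht).1) isClosed_closure)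
  rintro y ⟨⟨hyO, hyU⟩, hyG⟩
  exact hw (show (⟨y, hyU, hyG⟩ : ↥(U ∩ G)) ∈ Subtype.val ⁻¹' O from hyO)

open Set in
theorem sol_case1 {X Z : Type} [MetricSpace X] [CompactSpace X] [MeasurableSpace X] [BorelSpace X]
    [TopologicalSpace Z]
    (f : Z → X) (hf : Continuous f) (I : Set (Set X)) (A : Set X) (hA : MeasurableSet A)
    (hfA : ∀ z, f z ∈ A)
    (hunc : ∀ V : Set Z, IsOpen V → V.Nonempty → ¬ SolCov I (f '' V))
    (V : Set Z) (hV : IsOpen V) (hVn : V.Nonempty)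
    (h : ∀ L : Set X, IsClosed L → L ⊆ closure (f '' V \ L) → L ∈ I) :
    ∃ G : Set X, G.Nonempty ∧ IsGδ G ∧ G ⊆ A ∧
      ∀ U : Set X, IsOpen U → (U ∩ G).Nonempty → closure (U ∩ G) ∉ I := by
  set K := closure (f '' V) with hK
  have hKc : IsClosed K := isClosed_closure
  have : CompactSpace K := isCompact_iff_compactSpace.1 hKc.isCompact
  have hS : MeasurableSet ((Subtype.val : K → X) ⁻¹' A) := measurable_subtype_coe hA
  obtain ⟨u, huo, hSu⟩ := hS.residualEq_isOpen
  obtain ⟨t, htS, htG, htd⟩ := mem_residual.1 hSu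
  have hiff : ∀ x ∈ t, (x.1 ∈ A ↔ x ∈ u) := fun x hx => iff_of_eq (htS hx)
  have hune : u.Nonempty := by
    rw [nonempty_iff_ne_empty]
    rintro rfl
    have hm : IsMeagre ((Subtype.val : K → X) ⁻¹' A) := by
      refine Filter.mem_of_superset (residual_of_dense_Gδ htG htd) ?_
      intro x hx hxA
      exact ((hiff x hx).1 hxA)
    obtain ⟨T, hT, hTc, hsub⟩ := isMeagre_iff_countable_union_isNowhereDense.1 hm
    refine hunc V hV hVn ⟨(fun t => Subtype.val '' closure t) '' T, hTc.image _, ?_, ?_⟩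
    · rintro _ ⟨t, ht, rfl⟩
      have hLc : IsClosed ((Subtype.val : K → X) '' closure t) :=
        hKc.isClosedEmbedding_subtypeVal.isClosedMap _ isClosed_closure
      refine ⟨hLc, h _ hLc ?_⟩
      rintro _ ⟨x, hx, rfl⟩
      rw [mem_closure_iff]
      intro W hW hxW
      have hint : interior (closure t) = ∅ := hT t ht
      have hex : ∃ k : K, k.1 ∈ W ∧ k ∉ closure t := by
        by_contra hcon
        push Not at hcon
        have : x ∈ interior (closure t) :=
          mem_interior.2 ⟨Subtype.val ⁻¹' W, hcon, hW.preimage continuous_subtype_val, hxW⟩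
        rw [hint] at this
        exact this
      obtain ⟨k, hkW, hkt⟩ := hex
      have hkL : k.1 ∈ W \ (Subtype.val '' closure t) := by
        refine ⟨hkW, ?_⟩
        rintro ⟨k', hk', he⟩
        exact hkt (Subtype.ext he ▸ hk')
      obtain ⟨y, hy1, hy2⟩ := mem_closure_iff.1 k.2 _ (hW.sdiff hLc) hkL
      exact ⟨y, hy1.1, hy2, hy1.2⟩
    · rintro _ ⟨z, hz, rfl⟩
      obtain ⟨t, ht, hzt⟩ := hsub
        (show (⟨f z, subset_closure (mem_image_of_mem f hz)⟩ : K) ∈ _ from hfA z)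
      exact ⟨_, mem_image_of_mem _ ht, _, subset_closure hzt, rfl⟩
  obtain ⟨u', hu', rfl⟩ := isOpen_induced_iff.1 huo
  refine ⟨Subtype.val '' (Subtype.val ⁻¹' u' ∩ t), ?_, ?_, ?_, ?_⟩
  · exact (htd.inter_open_nonempty _ huo hune).image _
  · obtain ⟨O, hO, rfl⟩ := isGδ_iff_eq_iInter_nat.1 htG
    choose O' hO' hOO using fun n => isOpen_induced_iff.1 (hO n)
    have : (Subtype.val : K → X) '' (Subtype.val ⁻¹' u' ∩ ⋂ n, O n) = K ∩ u' ∩ ⋂ n, O' n := by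
      ext x
      simp only [← hOO]
      constructor
      · rintro ⟨y, ⟨h1, h2⟩, rfl⟩
        refine ⟨⟨y.2, h1⟩, mem_iInter.2 fun n => mem_iInter.1 h2 n⟩
      · rintro ⟨⟨h1, h2⟩, h3⟩
        exact ⟨⟨x, h1⟩, ⟨h2, mem_iInter.2 fun n => mem_iInter.1 h3 n⟩, rfl⟩
    rw [this]
    exact (hKc.isGδ.inter hu'.isGδ).inter (IsGδ.iInter_of_isOpen hO')
  · rintro _ ⟨y, ⟨h1, h2⟩, rfl⟩
    exact (hiff y h2).2 h1
  · rintro U hU ⟨_, hxU, ⟨x, ⟨hxu, hxt⟩, rfl⟩⟩ hmem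
    obtain ⟨_, ⟨hzU, hzu⟩, ⟨z, hz, rfl⟩⟩ := mem_closure_iff.1 x.2 _ (hU.inter hu') ⟨hxU, hxu⟩
    refine hunc (V ∩ f ⁻¹' (U ∩ u')) (hV.inter ((hU.inter hu').preimage hf)) ⟨z, hz, hzU, hzu⟩
      ⟨{closure (U ∩ Subtype.val '' (Subtype.val ⁻¹' u' ∩ t))}, countable_singleton _, ?_, ?_⟩
    · rintro _ rfl
      exact ⟨isClosed_closure, hmem⟩
    · rintro _ ⟨w, ⟨hwV, hwU, hwu⟩, rfl⟩
      rw [sUnion_singleton, mem_closure_iff]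
      intro W hW hwW
      obtain ⟨k, ⟨⟨hk1, hk2⟩, hk3⟩, hk4⟩ := mem_closure_iff.1
        (htd ⟨f w, subset_closure (mem_image_of_mem f hwV)⟩)
        (Subtype.val ⁻¹' (W ∩ U ∩ u')) (((hW.inter hU).inter hu').preimage continuous_subtype_val)
        ⟨⟨hwW, hwU⟩, hwu⟩
      exact ⟨k.1, hk1, hk2, k, ⟨hk3, hk4⟩, rfl⟩

open Set in
theorem sol_main {X : Type} [MetricSpace X] [CompactSpace X] [MeasurableSpace X] [BorelSpace X]
    (I : Set (Set X)) (hI : ∀ s ∈ I, ∀ t ⊆ s, IsClosed t → t ∈ I) (hI0 : ∅ ∈ I)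
    (A : Set X) (hA : MeasurableSet A) (hAI : ¬ SolCov I A) :
    ∃ G : Set X, G.Nonempty ∧ IsGδ G ∧ G ⊆ A ∧
      ∀ U : Set X, IsOpen U → (U ∩ G).Nonempty → ¬ SolCov I (U ∩ G) := by
  have han := hA.analyticSet
  rw [MeasureTheory.AnalyticSet] at han
  rcases han with rfl | ⟨f, hf, rfl⟩
  · exact absurd ⟨∅, countable_empty, by simp, by simp⟩ hAI
  let B := TopologicalSpace.countableBasis (ℕ → ℕ)
  have hBc : B.Countable := TopologicalSpace.countable_countableBasis _
  have hB : TopologicalSpace.IsTopologicalBasis B := TopologicalSpace.isBasis_countableBasis _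
  let C : Set (Set (ℕ → ℕ)) := {b ∈ B | SolCov I (f '' b)}
  have hCc : C.Countable := hBc.mono (sep_subset _ _)
  let P : Set (ℕ → ℕ) := (⋃₀ C)ᶜ
  have hPc : IsClosed P := (isOpen_sUnion fun b hb => hB.isOpen hb.1).isClosed_compl
  have hcov : ∀ b, SolCov I (f '' (b ∩ P)) → SolCov I (f '' b) := by
    rintro b ⟨T, hTc, hT, hsub⟩
    have hC2 : ∀ b ∈ C, SolCov I (f '' b) := fun b hb => hb.2
    choose! T' hTc' hT' hsub' using hC2
    refine ⟨T ∪ ⋃ b ∈ C, T' b, hTc.union (hCc.biUnion hTc'), ?_, ?_⟩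
    · rintro t (ht | ht)
      · exact hT t ht
      · simp only [mem_iUnion] at ht
        obtain ⟨b, hb, ht⟩ := ht
        exact hT' b hb t ht
    · rintro _ ⟨z, hz, rfl⟩
      by_cases hzP : z ∈ P
      · obtain ⟨t, ht, hzt⟩ := hsub (mem_image_of_mem f ⟨hz, hzP⟩)
        exact ⟨t, Or.inl ht, hzt⟩
      · obtain ⟨b', hb', hzb⟩ := not_not.1 hzP
        obtain ⟨t, ht, hzt⟩ := hsub' b' hb' (mem_image_of_mem f hzb)
        exact ⟨t, Or.inr (mem_biUnion hb' ht), hzt⟩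
  have hPne : P.Nonempty := by
    rw [nonempty_iff_ne_empty]
    intro hP
    apply hAI
    rw [← image_univ]
    apply hcov
    rw [hP]
    exact ⟨∅, countable_empty, by simp, by simp⟩
  have : Nonempty P := hPne.to_subtype
  have : PolishSpace P := hPc.polishSpace
  let g : P → X := fun z => f z.1
  have hg : Continuous g := hf.comp continuous_subtype_val
  have hunc : ∀ V : Set P, IsOpen V → V.Nonempty → ¬ SolCov I (g '' V) := by
    rintro V hV ⟨z, hz⟩ ⟨T, hTc, hT, hsub⟩
    obtain ⟨V', hV', rfl⟩ := isOpen_induced_iff.1 hV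
    obtain ⟨b, hb, hzb, hbV⟩ := hB.exists_subset_of_mem_open (show z.1 ∈ V' from hz) hV'
    refine z.2 ⟨b, ⟨hb, hcov b ⟨T, hTc, hT, ?_⟩⟩, hzb⟩
    rintro _ ⟨w, ⟨hwb, hwP⟩, rfl⟩
    exact hsub ⟨⟨w, hwP⟩, hbV hwb, rfl⟩
  suffices hs : ∃ G : Set X, G.Nonempty ∧ IsGδ G ∧ G ⊆ range f ∧
      ∀ U : Set X, IsOpen U → (U ∩ G).Nonempty → closure (U ∩ G) ∉ I by
    obtain ⟨G, h1, h2, h3, h4⟩ := hs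
    exact ⟨G, h1, h2, h3, sol_baire I hI G h2 h4⟩
  by_cases hcase : ∃ V : Set P, IsOpen V ∧ V.Nonempty ∧
      ∀ L : Set X, IsClosed L → L ⊆ closure (g '' V \ L) → L ∈ I
  · obtain ⟨V, hV, hVn, h⟩ := hcase
    exact sol_case1 g hg I _ hA (fun z => mem_range_self _) hunc V hV hVn h
  · push Not at hcase
    letI := TopologicalSpace.upgradeIsCompletelyMetrizable P
    obtain ⟨G, h1, h2, h3, h4⟩ := sol_case2 g hg I hI (fun V hV hVn => by
      obtain ⟨L, hL1, hL2, hL3⟩ := hcase V hV hVn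
      refine ⟨L, hL1, ?_, hL3, hL2⟩
      rw [nonempty_iff_ne_empty]
      rintro rfl
      exact hL3 hI0)
    refine ⟨G, h1, h2, h3.trans ?_, h4⟩
    rintro _ ⟨z, rfl⟩
    exact mem_range_self _


/-- Solecki-type consequence: if a σ-ideal `I` of Borel sets on a zero-dimensional compact
metric space `X` is not generated by its compact members (some set in `I` is covered by no
F_σ set from `I`), then there is a nonempty G_δ set `G ∈ I` no nonempty relatively open
subset of which is covered by an F_σ set from `I`; and for every such `G`, every Lusin set
`T` in `G` meets every compact set from `I` in a countable set. -/
theorem stmt_10 (X : Type) [MetricSpace X] [CompactSpace X]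
    [MeasurableSpace X] [BorelSpace X]
    (hzerodim : ∃ B : Set (Set X), (∀ s ∈ B, IsClopen s) ∧
      TopologicalSpace.IsTopologicalBasis B)
    (I : Set (Set X))
    (hIBorel : ∀ s ∈ I, MeasurableSet s)
    (hIsing : ∀ x : X, {x} ∈ I)
    (hIsub : ∀ s ∈ I, ∀ t, t ⊆ s → MeasurableSet t → t ∈ I)
    (hIunion : ∀ f : ℕ → Set X, (∀ n, f n ∈ I) → (⋃ n, f n) ∈ I)
    (hnotgen : ∃ s ∈ I, ∀ F : Set X,
      (∃ g : ℕ → Set X, (∀ n, IsClosed (g n)) ∧ F = ⋃ n, g n) → F ∈ I → ¬ s ⊆ F) :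
    (∃ G : Set X, G.Nonempty ∧ IsGδ G ∧ G ∈ I ∧
      ∀ U : Set X, IsOpen U → (U ∩ G).Nonempty →
        ∀ F : Set X, (∃ g : ℕ → Set X, (∀ n, IsClosed (g n)) ∧ F = ⋃ n, g n) →
          F ∈ I → ¬ (U ∩ G ⊆ F)) ∧
    ∀ G : Set X, G.Nonempty → IsGδ G → G ∈ I →
      (∀ U : Set X, IsOpen U → (U ∩ G).Nonempty →
        ∀ F : Set X, (∃ g : ℕ → Set X, (∀ n, IsClosed (g n)) ∧ F = ⋃ n, g n) →
          F ∈ I → ¬ (U ∩ G ⊆ F)) →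
      ∀ T : Set G, aleph 0 < #T →
        (∀ D : Set G, IsClosed D → interior D = ∅ → (T ∩ D).Countable) →
        ∀ K ∈ I, IsCompact K → (T ∩ (Subtype.val ⁻¹' K)).Countable := by
  have hclosed : ∀ s ∈ I, ∀ t ⊆ s, IsClosed t → t ∈ I :=
    fun s hs t hts ht => hIsub s hs t hts ht.measurableSet
  obtain ⟨A, hAI, hA⟩ := hnotgen
  have hI0 : ∅ ∈ I := hIsub A hAI ∅ (Set.empty_subset _) MeasurableSet.empty
  constructor
  · obtain ⟨G, h1, h2, h3, h4⟩ := sol_main I hclosed hI0 A (hIBorel A hAI) (by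
      rintro ⟨T, hTc, hT, hsub⟩
      obtain ⟨g, hg⟩ := (hTc.insert ∅).exists_eq_range (Set.insert_nonempty _ _)
      have hgT : ∀ n, IsClosed (g n) ∧ g n ∈ I := by
        intro n
        have : g n ∈ insert ∅ T := hg ▸ Set.mem_range_self n
        rcases this with h | h
        · rw [h]; exact ⟨isClosed_empty, hI0⟩
        · exact hT _ h
      refine hA _ ⟨g, fun n => (hgT n).1, rfl⟩ (hIunion g fun n => (hgT n).2) ?_
      intro x hx
      obtain ⟨t, ht, hxt⟩ := hsub hx
      have : t ∈ Set.range g := hg ▸ Set.mem_insert_of_mem _ ht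
      obtain ⟨n, rfl⟩ := this
      exact Set.mem_iUnion.2 ⟨n, hxt⟩)
    refine ⟨G, h1, h2, hIsub A hAI G h3 h2.measurableSet, ?_⟩
    rintro U hU hne F ⟨g, hg, rfl⟩ hF hsub
    refine h4 U hU hne ⟨Set.range g, Set.countable_range g, ?_, by rwa [Set.sUnion_range]⟩
    rintro _ ⟨n, rfl⟩
    exact ⟨hg n, hclosed _ hF _ (Set.subset_iUnion g n) (hg n)⟩
  · intro G _ _ _ hG T _ hT K hK hKc
    refine hT _ (hKc.isClosed.preimage continuous_subtype_val) ?_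
    rw [← Set.not_nonempty_iff_eq_empty]
    rintro ⟨x, hx⟩
    obtain ⟨w, hw, hwo, hxw⟩ := mem_interior.1 hx
    obtain ⟨O, hO, rfl⟩ := isOpen_induced_iff.1 hwo
    refine hG O hO ⟨x, hxw, x.2⟩ K ⟨fun _ => K, fun _ => hKc.isClosed, (Set.iUnion_const K).symm⟩ hK ?_
    rintro y ⟨hyO, hyG⟩
    exact hw (show (⟨y, hyG⟩ : G) ∈ Subtype.val ⁻¹' O from hyO)
end

section
/- Assume the Continuum Hypothesis. Then there exists a set E ⊆ [0,1]^ℕ of cardinality 𝔠 such that: (1) there is a continuous function f : E → [0,1]^ℕ such that for every subset A ⊆ E of cardinality 𝔠, the restriction of f to A is not uniformly continuous; and (2) for every continuous function g : E → ℝ there is r ∈ ℝ such that the set {x ∈ E : g(x) = r} has cardinality 𝔠. -/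
open Cardinal

section Aux
open Set Filter Topology

lemma unif_aux (V : Set ((ℕ → unitInterval) × (ℕ → unitInterval)))
    (hV : V ∈ uniformity (ℕ → unitInterval)) :
    ∃ (N : ℕ) (δ : ℝ), 0 < δ ∧ ∀ x y : ℕ → unitInterval,
      (∀ i < N, |(x i : ℝ) - y i| < δ) → (x, y) ∈ V := by
  rw [Pi.uniformity] at hV
  refine Filter.iInf_sets_induct hV ⟨0, 1, one_pos, fun _ _ _ => trivial⟩ ?_
  rintro i s1 s2 hs1 ⟨N, δ, hδ, h⟩
  obtain ⟨W, hW, hWs⟩ := hs1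
  obtain ⟨ε, hε, hεW⟩ := Metric.mem_uniformity_dist.1 hW
  refine ⟨max N (i+1), min δ ε, lt_min hδ hε, fun x y hxy => ⟨hWs (hεW ?_), h x y ?_⟩⟩
  · have := hxy i (lt_of_lt_of_le (Nat.lt_succ_self i) (le_max_right _ _))
    exact lt_of_lt_of_le this (min_le_right _ _)
  · intro j hj
    exact lt_of_lt_of_le (hxy j (lt_of_lt_of_le hj (le_max_left _ _))) (min_le_left _ _)

abbrev PP : Type := {x : ℕ → unitInterval // ∀ n, 0 < (x n : ℝ)}

lemma nhds_aux (p : PP) (U : Set PP) (hU : U ∈ 𝓝 p) :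
    ∃ N : ℕ, ∀ x : PP, (∀ i < N, x.1 i = p.1 i) → x ∈ U := by
  rw [nhds_subtype_eq_comap] at hU
  obtain ⟨W, hW, hWU⟩ := hU
  obtain ⟨V, hV, hVW⟩ := UniformSpace.mem_nhds_iff.1 hW
  obtain ⟨N, δ, hδ, h⟩ := unif_aux V hV
  refine ⟨N, fun x hx => hWU (hVW ?_)⟩
  refine h p.1 x.1 fun i hi => ?_
  rw [hx i hi]; simpa using hδ

noncomputable def psi (s : ℝ) : ℝ := Real.sin (Real.pi / (2 * s)) ^ 2

lemma psi_even (K : ℕ) (hK : 0 < K) : psi (1 / (2 * K)) = 0 := by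
  have : (K : ℝ) ≠ 0 := by positivity
  unfold psi
  rw [show Real.pi / (2 * (1 / (2 * (K:ℝ)))) = K * Real.pi by field_simp, Real.sin_nat_mul_pi]
  simp

lemma psi_odd (K : ℕ) : psi (1 / (2 * K + 1)) = 1 := by
  have : (2 * (K : ℝ) + 1) ≠ 0 := by positivity
  unfold psi
  rw [show Real.pi / (2 * (1 / (2 * (K:ℝ) + 1))) = K * Real.pi + Real.pi / 2 by field_simp,
    Real.sin_add_pi_div_two]
  have h := Real.sin_sq_add_cos_sq (K * Real.pi)
  rw [Real.sin_nat_mul_pi] at h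
  linarith

lemma coord_cont (n : ℕ) : Continuous fun x : PP => ((x.1 n : unitInterval) : ℝ) :=
  continuous_subtype_val.comp ((continuous_apply n).comp continuous_subtype_val)

lemma psi_cont (n : ℕ) : Continuous fun x : PP => psi (x.1 n) := by
  unfold psi
  have h1 : Continuous fun x : PP => ((x.1 n : unitInterval) : ℝ) := coord_cont n
  refine (Real.continuous_sin.comp (Continuous.div continuous_const (continuous_const.mul h1) ?_)).pow 2
  intro x
  have := x.2 n
  exact mul_ne_zero two_ne_zero this.ne'

def UC (F : Set PP) : Prop := ∀ n : ℕ, ∃ (N : ℕ) (δ : ℝ), 0 < δ ∧ ∀ x ∈ F, ∀ y ∈ F,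
  (∀ i < N, |(x.1 i : ℝ) - y.1 i| < δ) → |psi (x.1 n) - psi (y.1 n)| < 1

def SmallS (S : Set PP) : Prop := ∃ F : ℕ → Set PP, (∀ k, UC (F k)) ∧ S ⊆ ⋃ k, F k

lemma UC_closure (D : Set PP) (h : ∀ n : ℕ, ∃ (N : ℕ) (δ : ℝ), 0 < δ ∧ ∀ x ∈ D, ∀ y ∈ D,
    (∀ i < N, |(x.1 i : ℝ) - y.1 i| < δ) → |psi (x.1 n) - psi (y.1 n)| ≤ 1 / 2) :
    UC (closure D) := by
  intro n
  obtain ⟨N, δ, hδ, h⟩ := h n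
  refine ⟨N, δ, hδ, fun x hx y hy hxy => ?_⟩
  let R : Set (PP × PP) := {z | (∀ i < N, |(z.1.1 i : ℝ) - z.2.1 i| < δ) →
    |psi (z.1.1 n) - psi (z.2.1 n)| ≤ 1 / 2}
  have hR : IsClosed R := by
    have e : R = {z | ∀ i < N, |(z.1.1 i : ℝ) - z.2.1 i| < δ}ᶜ ∪
        {z | |psi (z.1.1 n) - psi (z.2.1 n)| ≤ 1 / 2} := by
      ext z; simp only [R, mem_ofPred_eq, mem_union, mem_compl_iff]; tauto
    rw [e]
    refine IsClosed.union (IsOpen.isClosed_compl ?_) ?_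
    · have : {z : PP × PP | ∀ i < N, |(z.1.1 i : ℝ) - z.2.1 i| < δ} =
          ⋂ i ∈ Finset.range N, {z | |(z.1.1 i : ℝ) - z.2.1 i| < δ} := by
        ext z; simp
      rw [this]
      refine isOpen_biInter_finset fun i _ => isOpen_lt ?_ continuous_const
      exact (((coord_cont i).comp continuous_fst).sub ((coord_cont i).comp continuous_snd)).abs
    · have h1 := (psi_cont n).comp (continuous_fst (X := PP) (Y := PP))
      have h2 := (psi_cont n).comp (continuous_snd (X := PP) (Y := PP))
      exact isClosed_le (h1.sub h2).abs continuous_const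
  have hsub : D ×ˢ D ⊆ R := fun z hz => h z.1 hz.1 z.2 hz.2
  have hm : (x, y) ∈ closure (D ×ˢ D) := by rw [closure_prod_eq]; exact ⟨hx, hy⟩
  have := closure_minimal hsub hR hm hxy
  simp only at this
  linarith

noncomputable def mix (a b s : unitInterval) : unitInterval :=
  ⟨(1 - (s:ℝ)) * a + s * b, by
    have := s.2; have := a.2; have := b.2
    simp only [mem_Icc] at *
    constructor <;> nlinarith⟩

lemma mix_cont (a b : unitInterval) : Continuous (mix a b) := by
  unfold mix; fun_prop

lemma mix_zero (a b : unitInterval) : mix a b 0 = a := by ext; simp [mix]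
lemma mix_one (a b : unitInterval) : mix a b 1 = b := by ext; simp [mix]

lemma mix_pos (a b s : unitInterval) (ha : 0 < (a:ℝ)) (hb : 0 < (b:ℝ)) : 0 < (mix a b s : ℝ) := by
  have h := s.2
  simp only [mem_Icc] at h
  simp only [mix]
  rcases h.1.eq_or_lt with h0 | h0
  · rw [← h0]; simpa
  · have : 0 ≤ (1 - (s:ℝ)) * a := mul_nonneg (by linarith) ha.le
    have : 0 < (s:ℝ) * b := mul_pos h0 hb
    linarith

lemma mix_lt (a b s : unitInterval) (δ : ℝ) (ha : (a:ℝ) < δ) (hb : (b:ℝ) < δ) :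
    (mix a b s : ℝ) < δ := by
  have h := s.2
  simp only [mem_Icc] at h
  simp only [mix]
  rcases h.1.eq_or_lt with h0 | h0
  · rw [← h0]; simpa
  · have : (1 - (s:ℝ)) * a ≤ (1 - s) * δ := mul_le_mul_of_nonneg_left ha.le (by linarith)
    have : (s:ℝ) * b < s * δ := mul_lt_mul_of_pos_left hb h0
    linarith

theorem luzin {P ι κ : Type} [Nonempty P] [Nonempty ι] [Nonempty κ] (hι : #ι ≤ aleph 1)
    (hκ : #κ ≤ aleph 1)
    (F : ι → Set P) (T : κ → Set P)
    (H : ∀ k, ∀ c : Set ι, c.Countable → ∀ s : Set P, s.Countable →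
      ∃ p ∈ T k, (∀ i ∈ c, p ∉ F i) ∧ p ∉ s) :
    ∃ E : Set P, (∀ i, (E ∩ F i).Countable) ∧ ∀ k, ¬ (E ∩ T k).Countable := by
  let W := (aleph 1).ord.ToType
  have hW : #W = aleph 1 := mk_ord_toType _
  have hseg : ∀ w : W, (Iio w).Countable := fun w => by
    have h : #(Iio w) < aleph 1 := mk_Iio_toType_ord_lt w
    have := (Cardinal.lt_aleph_one_iff).1 h
    exact Cardinal.le_aleph0_iff_set_countable.1 this
  have hWu : ¬ (univ : Set W).Countable := by
    intro h
    have := Cardinal.le_aleph0_iff_set_countable.2 h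
    rw [Cardinal.mk_univ, hW] at this
    exact absurd this (not_le.2 aleph0_lt_aleph_one)
  have hWne : Nonempty W := by
    by_contra hne
    rw [not_nonempty_iff] at hne
    exact hWu (Set.to_countable _)
  obtain ⟨a, ha⟩ : ∃ a : W → ι, Function.Surjective a := by
    have : #ι ≤ #W := by rw [hW]; exact hι
    obtain ⟨e⟩ := this
    exact ⟨Function.invFun e, Function.invFun_surjective e.injective⟩
  obtain ⟨π, hπ⟩ : ∃ π : W → κ × W, Function.Surjective π := by
    have : #(κ × W) ≤ #W := by
      rw [Cardinal.mk_prod, hW]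
      simp only [Cardinal.lift_id]
      calc #κ * aleph 1 ≤ aleph 1 * aleph 1 := mul_le_mul_left hκ _
        _ = aleph 1 := Cardinal.mul_eq_self (aleph0_le_aleph 1)
    obtain ⟨e⟩ := this
    exact ⟨Function.invFun e, Function.invFun_surjective e.injective⟩
  have H' : ∀ (w : W) (s : Set P), s.Countable →
      ∃ p, p ∈ T (π w).1 ∧ (∀ w' < w, p ∉ F (a w')) ∧ p ∉ s := by
    intro w s hs
    obtain ⟨p, hp, h1, h2⟩ := H (π w).1 (a '' Iio w) ((hseg w).image a) s hs
    exact ⟨p, hp, fun w' hw' => h1 _ ⟨w', hw', rfl⟩, h2⟩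
  choose! h hh1 hh2 hh3 using H'
  have wf : WellFounded (fun x y : W => x < y) := wellFounded_lt
  let x : W → P := wf.fix (fun w rec => h w {p | ∃ w', ∃ hw : w' < w, p = rec w' hw})
  have hx : ∀ w, x w = h w (x '' Iio w) := by
    intro w
    have := wf.fix_eq (fun w (rec : ∀ w', w' < w → P) => h w {p | ∃ w', ∃ hw : w' < w, p = rec w' hw}) w
    refine this.trans ?_
    congr 1
    ext p
    simp only [mem_ofPred_eq, mem_image, mem_Iio, exists_prop]
    constructor
    · rintro ⟨w', hw, rfl⟩; exact ⟨w', hw, rfl⟩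
    · rintro ⟨w', hw, rfl⟩; exact ⟨w', hw, rfl⟩
  have hc : ∀ w, (x '' Iio w).Countable := fun w => (hseg w).image x
  have x1 : ∀ w, x w ∈ T (π w).1 := fun w => by rw [hx]; exact hh1 _ _ (hc w)
  have x2 : ∀ w, ∀ w' < w, x w ∉ F (a w') := fun w => by rw [hx]; exact hh2 _ _ (hc w)
  have x3 : ∀ w, ∀ w' < w, x w ≠ x w' := fun w w' hw e => by
    have := hh3 w _ (hc w)
    rw [← hx] at this
    exact this ⟨w', hw, e.symm⟩
  have xinj : Function.Injective x := by
    intro u v e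
    rcases lt_trichotomy u v with h | h | h
    · exact absurd e.symm (x3 v u h)
    · exact h
    · exact absurd e (x3 u v h)
  refine ⟨range x, fun i => ?_, fun k hk => ?_⟩
  · obtain ⟨w', rfl⟩ := ha i
    have : range x ∩ F (a w') ⊆ x '' (insert w' (Iio w')) := by
      rintro _ ⟨⟨w, rfl⟩, hw⟩
      refine ⟨w, ?_, rfl⟩
      by_contra hcon
      simp only [mem_insert_iff, mem_Iio, not_or, not_lt] at hcon
      exact x2 w w' (lt_of_le_of_ne hcon.2 (Ne.symm hcon.1)) hw
    exact (((hseg w').insert w').image x).mono this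
  · have h1 : (x ⁻¹' (range x ∩ T k)).Countable := hk.preimage xinj
    have h2 : (univ : Set W) ⊆ (fun w => (π w).2) '' (x ⁻¹' (range x ∩ T k)) := by
      intro w _
      obtain ⟨u, hu⟩ := hπ (k, w)
      refine ⟨u, ⟨⟨u, rfl⟩, ?_⟩, by simp [hu]⟩
      have := x1 u
      rwa [hu] at this
    exact hWu ((h1.image _).mono h2)

lemma step (F : Set PP) (hF : UC F) (n : ℕ) (α : unitInterval → PP) (hα : Continuous α) :
    ∃ (N : ℕ) (β : unitInterval → PP), n < N ∧ Continuous β ∧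
      (∀ t, ∀ i < n, (β t).1 i = (α t).1 i) ∧
      ∀ x ∈ F, ∀ t, ¬ ∀ i < N, x.1 i = (β t).1 i := by
  obtain ⟨N1, δ1, hδ1, h1⟩ := hF n
  obtain ⟨N2, δ2, hδ2, h2⟩ := hF (n+1)
  set N := max (max N1 N2) (n+2) with hN
  set δ := min δ1 δ2 with hδdef
  have hδ : 0 < δ := lt_min hδ1 hδ2
  have hN1 : N1 ≤ N := (le_max_left _ _).trans (le_max_left _ _)
  have hN2 : N2 ≤ N := (le_max_right _ _).trans (le_max_left _ _)
  have hNn : n + 2 ≤ N := le_max_right _ _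
  have hmod : ∀ e < 2, ∀ x ∈ F, ∀ y ∈ F, (∀ i < N, |(x.1 i : ℝ) - y.1 i| < δ) →
      |psi (x.1 (n+e)) - psi (y.1 (n+e))| < 1 := by
    intro e he x hx y hy hxy
    interval_cases e
    · exact h1 x hx y hy fun i hi => (hxy i (hi.trans_le hN1)).trans_le (min_le_left _ _)
    · exact h2 x hx y hy fun i hi => (hxy i (hi.trans_le hN2)).trans_le (min_le_right _ _)
  -- uniform continuity of α
  obtain ⟨η, hη, hηα⟩ : ∃ η > 0, ∀ t t' : unitInterval, |(t:ℝ) - t'| < η → ∀ i < n,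
      |((α t).1 i : ℝ) - (α t').1 i| < δ := by
    have hc : Continuous fun t => (fun i : Fin n => ((α t).1 i : ℝ)) :=
      continuous_pi fun i => (coord_cont i).comp hα
    have hu := CompactSpace.uniformContinuous_of_continuous hc
    obtain ⟨η, hη, h⟩ := Metric.uniformContinuous_iff.1 hu δ hδ
    refine ⟨η, hη, fun t t' htt i hi => ?_⟩
    have := h (a := t) (b := t') htt
    exact (dist_pi_lt_iff hδ).1 this ⟨i, hi⟩
  obtain ⟨m, hm⟩ := exists_nat_one_div_lt hη
  obtain ⟨K, hK⟩ := exists_nat_one_div_lt hδ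
  set M : ℝ := (m:ℝ) + 1 with hM
  have hMpos : 0 < M := by positivity
  have hK0 : (0:ℝ) ≤ K := Nat.cast_nonneg _
  let a : unitInterval := ⟨1 / (2 * ((K+1 : ℕ):ℝ)), by positivity, by
    rw [div_le_one (by positivity)]; push_cast; linarith⟩
  let b : unitInterval := ⟨1 / (2 * ((K+1 : ℕ):ℝ) + 1), by positivity, by
    rw [div_le_one (by positivity)]; push_cast; linarith⟩
  have ha0 : 0 < (a:ℝ) := by simp only [a]; positivity
  have hb0 : 0 < (b:ℝ) := by simp only [b]; positivity
  have haδ : (a:ℝ) < δ := by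
    refine lt_of_le_of_lt ?_ hK
    simp only [a]
    apply one_div_le_one_div_of_le (by positivity); push_cast; linarith
  have hbδ : (b:ℝ) < δ := by
    refine lt_of_le_of_lt ?_ hK
    simp only [b]
    apply one_div_le_one_div_of_le (by positivity); push_cast; linarith
  have hpa : psi a = 0 := psi_even (K+1) (Nat.succ_pos _)
  have hpb : psi b = 1 := psi_odd (K+1)
  let J : ℕ → Set unitInterval := fun j => {t | (j:ℝ) ≤ M * t ∧ M * t ≤ j + 1}
  have hJf : Continuous fun t : unitInterval => M * (t:ℝ) := by fun_prop
  have hJc : ∀ j, IsClosed (J j) := fun j => by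
    have h1 : IsClosed {t : unitInterval | (j:ℝ) ≤ M * t} := isClosed_le continuous_const hJf
    have h2 : IsClosed {t : unitInterval | M * t ≤ (j:ℝ) + 1} := isClosed_le hJf continuous_const
    exact h1.inter h2
  let Hit : ℕ → ℕ → ℝ → Prop := fun e j c => ∃ x ∈ F, ∃ t ∈ J j, (∀ l < n, x.1 l = (α t).1 l) ∧
    (x.1 n : ℝ) < δ ∧ (x.1 (n+1) : ℝ) < δ ∧ (∀ l, n + 2 ≤ l → l < N → x.1 l = 1) ∧
    psi (x.1 (n+e)) = c
  have hHit : ∀ e < 2, ∀ j, Hit e j 0 → ¬ Hit e j 1 := by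
    rintro e he j ⟨x, hx, t, ht, hx1, hx2, hx3, hx4, hx5⟩ ⟨y, hy, t', ht', hy1, hy2, hy3, hy4, hy5⟩
    have := hmod e he x hx y hy ?_
    · rw [hx5, hy5] at this; norm_num at this
    intro i hi
    have hxp := x.2
    have hyp := y.2
    rcases lt_or_ge i n with h | h
    · rw [hx1 i h, hy1 i h]
      refine hηα t t' (lt_of_le_of_lt ?_ hm) i h
      obtain ⟨u1, u2⟩ := ht
      obtain ⟨u3, u4⟩ := ht'
      rw [le_div_iff₀ hMpos]
      have : |(t:ℝ) - t'| * M = |M * t - M * t'| := by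
        rw [← mul_sub, abs_mul, abs_of_pos hMpos, mul_comm]
      rw [this, abs_le]; constructor <;> linarith
    · rcases h.eq_or_lt with rfl | h
      · rw [abs_lt]; have := hxp n; have := hyp n; constructor <;> linarith
      · rcases (Nat.succ_le_of_lt h).eq_or_lt with h' | h'
        · have h' : i = n + 1 := h'.symm
          subst h'
          rw [abs_lt]; have := hxp (n+1); have := hyp (n+1); constructor <;> linarith
        · rw [hx4 i h' hi, hy4 i h' hi]; simpa using hδ
  -- interpolating functions
  have hφ : ∀ e : ℕ, ∃ φ : unitInterval → unitInterval, Continuous φ ∧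
      ∀ j ≤ m, j % 2 = e → ∀ t ∈ J j, (¬ Hit e j 0 → φ t = 0) ∧ (Hit e j 0 → φ t = 1) := by
    intro e
    let A0 : Set unitInterval := ⋃ j ∈ {j ∈ Set.Iic m | j % 2 = e ∧ ¬ Hit e j 0}, J j
    let A1 : Set unitInterval := ⋃ j ∈ {j ∈ Set.Iic m | j % 2 = e ∧ Hit e j 0}, J j
    have c0 : IsClosed A0 := Set.Finite.isClosed_biUnion ((Set.finite_Iic m).subset
      (fun j hj => hj.1)) fun j _ => hJc j
    have c1 : IsClosed A1 := Set.Finite.isClosed_biUnion ((Set.finite_Iic m).subset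
      (fun j hj => hj.1)) fun j _ => hJc j
    have hd : Disjoint A0 A1 := by
      rw [Set.disjoint_left]
      intro t h0 h1
      simp only [A0, A1, mem_iUnion, exists_prop] at h0 h1
      obtain ⟨j, ⟨-, hj1, hj2⟩, hj3, hj4⟩ := h0
      obtain ⟨k, ⟨-, hk1, hk2⟩, hk3, hk4⟩ := h1
      have e1 : (j:ℝ) ≤ k + 1 := hj3.trans hk4
      have e2 : (k:ℝ) ≤ j + 1 := hk3.trans hj4
      have e1 : j ≤ k + 1 := by exact_mod_cast e1
      have e2 : k ≤ j + 1 := by exact_mod_cast e2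
      have : j = k := by omega
      subst this
      exact hj2 hk2
    obtain ⟨f, f0, f1, f2⟩ := exists_continuous_zero_one_of_isClosed c0 c1 hd
    refine ⟨fun t => ⟨f t, f2 t⟩, Continuous.subtype_mk f.continuous _, ?_⟩
    intro j hj hje t ht
    constructor
    · intro h
      have : t ∈ A0 := mem_biUnion (show j ∈ {j ∈ Set.Iic m | j % 2 = e ∧ ¬ Hit e j 0} from
        ⟨hj, hje, h⟩) ht
      ext; exact f0 this
    · intro h
      have : t ∈ A1 := mem_biUnion (show j ∈ {j ∈ Set.Iic m | j % 2 = e ∧ Hit e j 0} from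
        ⟨hj, hje, h⟩) ht
      ext; exact f1 this
  choose φ hφc hφ using hφ
  let β : unitInterval → PP := fun t => ⟨fun l => if l < n then (α t).1 l else
    if l < n + 2 then mix a b (φ (l - n) t) else 1, by
      intro l
      simp only
      split_ifs
      · exact (α t).2 l
      · exact mix_pos _ _ _ ha0 hb0
      · simp⟩
  have hβ1 : ∀ t, ∀ l < n, (β t).1 l = (α t).1 l := fun t l hl => by simp [β, hl]
  have hβ2 : ∀ t, ∀ e < 2, (β t).1 (n+e) = mix a b (φ e t) := fun t e he => by simp [β, he]
  have hβ3 : ∀ t l, n + 2 ≤ l → (β t).1 l = 1 := fun t l hl => by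
    simp only [β]; rw [if_neg (by omega), if_neg (by omega)]
  refine ⟨N, β, by omega, ?_, hβ1, ?_⟩
  · refine Continuous.subtype_mk (continuous_pi fun l => ?_) _
    split_ifs
    · exact (continuous_apply l).comp (continuous_subtype_val.comp hα)
    · exact (mix_cont a b).comp (hφc _)
    · exact continuous_const
  · intro x hx t hxt
    have ht := t.2
    set j := ⌊M * (t:ℝ)⌋₊ ⊓ m with hj
    have htJ : t ∈ J j := by
      have hnn : 0 ≤ M * (t:ℝ) := mul_nonneg hMpos.le ht.1
      have hle : M * (t:ℝ) ≤ m + 1 := by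
        calc M * (t:ℝ) ≤ M * 1 := mul_le_mul_of_nonneg_left ht.2 hMpos.le
          _ = m + 1 := by rw [mul_one]
      have g1 := Nat.floor_le hnn
      have g2 := Nat.lt_floor_add_one (M * (t:ℝ))
      rcases le_total ⌊M * (t:ℝ)⌋₊ m with h | h
      · rw [inf_eq_left.2 h] at hj
        rw [hj]; exact ⟨g1, g2.le⟩
      · rw [inf_eq_right.2 h] at hj
        rw [hj]
        refine ⟨le_trans ?_ g1, hle⟩
        exact_mod_cast h
    have hjm : j ≤ m := inf_le_right
    have he : j % 2 < 2 := Nat.mod_lt _ two_pos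
    have hh := hφ (j % 2) j hjm rfl t htJ
    have hxe : x.1 (n + j % 2) = mix a b (φ (j % 2) t) := by
      rw [hxt _ (by omega), hβ2 t _ he]
    have key : ∀ c, psi (x.1 (n + j % 2)) = c → Hit (j % 2) j c := by
      intro c hc
      refine ⟨x, hx, t, htJ, fun l hl => by rw [hxt l (by omega), hβ1 t l hl], ?_, ?_, ?_, hc⟩
      · rw [hxt n (by omega), show n = n + 0 from rfl, hβ2 t 0 (by omega)]
        exact mix_lt _ _ _ _ haδ hbδ
      · rw [hxt (n+1) (by omega), hβ2 t 1 (by omega)]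
        exact mix_lt _ _ _ _ haδ hbδ
      · intro l hl hlN
        rw [hxt l hlN, hβ3 t l hl]
    by_cases hc : Hit (j % 2) j 0
    · refine hHit _ he j hc (key 1 ?_)
      rw [hxe, hh.2 hc, mix_one, hpb]
    · refine hc (key 0 ?_)
      rw [hxe, hh.1 hc, mix_zero, hpa]

lemma path_lemma (F : ℕ → Set PP) (hF : ∀ k, UC (F k)) (N0 : ℕ) (p q : PP) :
    ∃ γ : unitInterval → PP, Continuous γ ∧ (∀ i < N0, (γ 0).1 i = p.1 i) ∧
      (∀ i < N0, (γ 1).1 i = q.1 i) ∧ ∀ t k, γ t ∉ F k := by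
  choose! N β hN hβ hβα hβF using fun k => step (F k) (hF k)
  let α0 : unitInterval → PP := fun t => ⟨fun i => mix (p.1 i) (q.1 i) t,
    fun i => mix_pos _ _ _ (p.2 i) (q.2 i)⟩
  have hα0 : Continuous α0 :=
    Continuous.subtype_mk (continuous_pi fun i => mix_cont _ _) _
  let s : ℕ → ℕ × (unitInterval → PP) := fun k =>
    Nat.rec (N0, α0) (fun k z => (N k z.1 z.2, β k z.1 z.2)) k
  have s0 : s 0 = (N0, α0) := rfl
  have s1 : ∀ k, s (k+1) = (N k (s k).1 (s k).2, β k (s k).1 (s k).2) := fun k => rfl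
  have sc : ∀ k, Continuous (s k).2 := by
    intro k
    induction k with
    | zero => exact hα0
    | succ k ih => rw [s1]; exact hβ k _ _ ih
  have sn : ∀ k, (s k).1 < (s (k+1)).1 := fun k => by rw [s1]; exact hN k _ _ (sc k)
  have smono : StrictMono fun k => (s k).1 := strictMono_nat_of_lt_succ sn
  have sag : ∀ k l, k ≤ l → ∀ t, ∀ i < (s k).1, ((s l).2 t).1 i = ((s k).2 t).1 i := by
    intro k l hkl t i hi
    induction l, hkl using Nat.le_induction with
    | base => rfl
    | succ l hl ih =>
      rw [← ih, s1]
      exact hβα l _ _ (sc l) t i (lt_of_lt_of_le hi (smono.monotone hl))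
  have sbig : ∀ i, i < (s (i+1)).1 := fun i => lt_of_lt_of_le (Nat.lt_succ_self i) (smono.id_le (i+1))
  let γ : unitInterval → PP := fun t => ⟨fun i => ((s (i+1)).2 t).1 i, fun i => ((s (i+1)).2 t).2 i⟩
  have hγ : ∀ k t, ∀ i < (s k).1, (γ t).1 i = ((s k).2 t).1 i := by
    intro k t i hi
    rcases le_total k (i+1) with h | h
    · exact sag k (i+1) h t i hi
    · exact (sag (i+1) k h t i (sbig i)).symm
  refine ⟨γ, ?_, ?_, ?_, ?_⟩
  · refine Continuous.subtype_mk (continuous_pi fun i => ?_) _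
    exact (continuous_apply i).comp (continuous_subtype_val.comp (sc (i+1)))
  · intro i hi
    rw [hγ 0 0 i hi]; exact mix_zero _ _
  · intro i hi
    rw [hγ 0 1 i hi]; exact mix_one _ _
  · intro t k hk
    refine hβF k (s k).1 (s k).2 (sc k) (γ t) hk t ?_
    have := hγ (k+1) t
    rw [s1] at this
    exact this

lemma SmallS.union {A B : Set PP} (hA : SmallS A) (hB : SmallS B) : SmallS (A ∪ B) := by
  obtain ⟨F, hF, hAF⟩ := hA
  obtain ⟨G, hG, hBG⟩ := hB
  refine ⟨fun k => if k % 2 = 0 then F (k / 2) else G (k / 2), fun k => ?_, ?_⟩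
  · simp only; split_ifs
    · exact hF _
    · exact hG _
  · rintro x (hx | hx)
    · obtain ⟨k, hk⟩ := mem_iUnion.1 (hAF hx)
      refine mem_iUnion.2 ⟨2 * k, ?_⟩
      simpa using hk
    · obtain ⟨k, hk⟩ := mem_iUnion.1 (hBG hx)
      refine mem_iUnion.2 ⟨2 * k + 1, ?_⟩
      rw [if_neg (by omega), show (2 * k + 1) / 2 = k by omega]
      exact hk

def onePP : PP := ⟨fun _ => 1, fun _ => by simp⟩

lemma path_small (S : Set PP) (hS : SmallS S) (N0 : ℕ) (p q : PP) :
    ∃ γ : unitInterval → PP, Continuous γ ∧ (∀ i < N0, (γ 0).1 i = p.1 i) ∧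
      (∀ i < N0, (γ 1).1 i = q.1 i) ∧ ∀ t, γ t ∉ S := by
  obtain ⟨F, hF, hSF⟩ := hS
  obtain ⟨γ, h1, h2, h3, h4⟩ := path_lemma F hF N0 p q
  refine ⟨γ, h1, h2, h3, fun t ht => ?_⟩
  obtain ⟨k, hk⟩ := mem_iUnion.1 (hSF ht)
  exact h4 t k hk

lemma fibre_lemma (G : Set PP) (g : PP → ℝ) (hg : ContinuousOn g G) (hG : SmallS Gᶜ) :
    ∃ r, ¬ SmallS {x | x ∈ G ∧ g x = r} := by
  by_contra hcon
  push Not at hcon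
  have key : ∀ p ∈ G, ∀ q ∈ G, ¬ g p < g q := by
    intro p hp q hq hpq
    obtain ⟨r, hr1, hr2⟩ := exists_between hpq
    have u1 : {x | x ∈ G → g x < r} ∈ 𝓝 p := by
      have := (hg p hp).eventually (gt_mem_nhds hr1)
      exact eventually_nhdsWithin_iff.1 this
    have u2 : {x | x ∈ G → r < g x} ∈ 𝓝 q := by
      have := (hg q hq).eventually (lt_mem_nhds hr2)
      exact eventually_nhdsWithin_iff.1 this
    obtain ⟨N1, hN1⟩ := nhds_aux p _ u1
    obtain ⟨N2, hN2⟩ := nhds_aux q _ u2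
    obtain ⟨γ, h1, h2, h3, h4⟩ := path_small _ (hG.union (hcon r)) (max N1 N2) p q
    have h5 : ∀ t, γ t ∈ G := fun t => by
      by_contra h; exact h4 t (Or.inl h)
    have hc : Continuous fun t => g (γ t) := hg.comp_continuous h1 h5
    have i1 : g (γ 0) < r := hN1 (γ 0) (fun i hi => h2 i (lt_of_lt_of_le hi (le_max_left _ _))) (h5 0)
    have i2 : r < g (γ 1) := hN2 (γ 1) (fun i hi => h3 i (lt_of_lt_of_le hi (le_max_right _ _))) (h5 1)
    obtain ⟨t, ht⟩ := mem_range_of_exists_le_of_exists_ge hc ⟨0, i1.le⟩ ⟨1, i2.le⟩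
    exact h4 t (Or.inr ⟨h5 t, ht⟩)
  obtain ⟨γ, -, -, -, h4⟩ := path_small _ hG 0 onePP onePP
  have hp : γ 0 ∈ G := by by_contra h; exact h4 0 h
  obtain ⟨γ', -, -, -, h4'⟩ := path_small _ (hG.union (hcon (g (γ 0)))) 0 onePP onePP
  have hp' : γ' 0 ∈ G := by by_contra h; exact h4' 0 (Or.inl h)
  exact h4' 0 (Or.inr ⟨hp', le_antisymm (not_lt.1 (key _ hp _ hp')) (not_lt.1 (key _ hp' _ hp))⟩)

/-- domain of the extension -/
def Dom (d : ℕ → PP) (v : ℕ → ℝ) : Set PP :=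
  {x | (comap d (𝓝 x)).NeBot ∧ ∃ y, Tendsto v (comap d (𝓝 x)) (𝓝 y)}

noncomputable def ExtF (d : ℕ → PP) (v : ℕ → ℝ) (x : PP) : ℝ := limUnder (comap d (𝓝 x)) v

lemma ext_cont (d : ℕ → PP) (v : ℕ → ℝ) : ContinuousOn (ExtF d v) (Dom d v) := by
  have hlim : ∀ x ∈ Dom d v, Tendsto v (comap d (𝓝 x)) (𝓝 (ExtF d v x)) := by
    intro x hx
    exact tendsto_nhds_limUnder hx.2
  intro x hx
  unfold ContinuousWithinAt
  rw [(closed_nhds_basis (ExtF d v x)).tendsto_right_iff]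
  rintro V ⟨hV, hVc⟩
  obtain ⟨U, hU, hUV⟩ := (hlim x hx) hV
  obtain ⟨U', hU', hUo, hxU⟩ := mem_nhds_iff.1 hU
  filter_upwards [mem_nhdsWithin_of_mem_nhds (hUo.mem_nhds hxU), self_mem_nhdsWithin] with z hz hzG
  have := hzG.1
  refine hVc.mem_of_tendsto (hlim z hzG) ?_
  have : d ⁻¹' U ∈ comap d (𝓝 z) := preimage_mem_comap (mem_of_superset (hUo.mem_nhds hz) hU')
  filter_upwards [this] with k hk
  exact hUV hk

lemma target_lemma (d : ℕ → PP) (v : ℕ → ℝ) : ∃ T : Set PP, ¬ SmallS T ∧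
    (T = (Dom d v)ᶜ ∨ ∃ r, T = {x | x ∈ Dom d v ∧ ExtF d v x = r}) := by
  by_cases h : SmallS (Dom d v)ᶜ
  · obtain ⟨r, hr⟩ := fibre_lemma _ _ (ext_cont d v) h
    exact ⟨_, hr, Or.inr ⟨r, rfl⟩⟩
  · exact ⟨_, h, Or.inl rfl⟩

lemma UC_empty : UC ∅ := fun _ => ⟨0, 1, one_pos, fun _ h => absurd h (by simp)⟩

lemma UC_singleton (p : PP) : UC {p} := fun n => ⟨0, 1, one_pos, by
  rintro x rfl y rfl _; simp⟩

lemma small_of_countable {c : Set (Set PP)} (hc : c.Countable) (h : ∀ F ∈ c, UC F) :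
    SmallS (⋃₀ c) := by
  rcases c.eq_empty_or_nonempty with rfl | hne
  · exact ⟨fun _ => ∅, fun _ => UC_empty, by simp⟩
  · obtain ⟨f, rfl⟩ := hc.exists_eq_range hne
    exact ⟨f, fun k => h _ ⟨k, rfl⟩, by rw [sUnion_range]⟩

lemma SmallS.mono {A B : Set PP} (hB : SmallS B) (h : A ⊆ B) : SmallS A := by
  obtain ⟨F, hF, hBF⟩ := hB
  exact ⟨F, hF, h.trans hBF⟩

lemma mk_PP_le : #PP ≤ continuum := by
  refine (mk_subtype_le _).trans ?_
  have : #unitInterval ≤ continuum := (mk_subtype_le _).trans Cardinal.mk_real.le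
  calc #(ℕ → unitInterval) = #unitInterval ^ ℵ₀ := by simp
    _ ≤ continuum ^ ℵ₀ := Cardinal.power_le_power_right this
    _ = continuum := continuum_power_aleph0

theorem exists_E (CH : (continuum : Cardinal.{0}) = aleph 1) : ∃ E : Set PP,
    (∀ F : Set PP, (∃ d : ℕ → PP, F = closure (range d)) → UC F → (E ∩ F).Countable) ∧
    ∀ d v, ∃ T : Set PP, ¬ (E ∩ T).Countable ∧
      (T = (Dom d v)ᶜ ∨ ∃ r, T = {x | x ∈ Dom d v ∧ ExtF d v x = r}) := by
  classical
  choose T hT1 hT2 using target_lemma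
  let F : (ℕ → PP) → Set PP := fun d => if UC (closure (range d)) then closure (range d) else ∅
  have hF : ∀ d, UC (F d) := fun d => by
    simp only [F]; split_ifs with h
    · exact h
    · exact UC_empty
  have : Nonempty PP := ⟨onePP⟩
  have c1 : #(ℕ → PP) ≤ continuum := by
    calc #(ℕ → PP) = #PP ^ ℵ₀ := by simp
      _ ≤ continuum ^ ℵ₀ := Cardinal.power_le_power_right mk_PP_le
      _ = continuum := continuum_power_aleph0
  have c2 : #((ℕ → PP) × (ℕ → ℝ)) ≤ continuum := by
    have : #(ℕ → ℝ) = continuum := by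
      calc #(ℕ → ℝ) = #ℝ ^ ℵ₀ := by simp
        _ = continuum := by rw [Cardinal.mk_real, continuum_power_aleph0]
    rw [Cardinal.mk_prod, this]
    simp only [Cardinal.lift_id]
    calc _ ≤ continuum * continuum := mul_le_mul_left c1 _
      _ = continuum := continuum_mul_self
  obtain ⟨E, hE1, hE2⟩ := luzin (c1.trans CH.le) (c2.trans CH.le) F
    (fun z => T z.1 z.2) (by
      intro z c hc s hs
      by_contra hcon
      push Not at hcon
      refine hT1 z.1 z.2 ?_
      refine SmallS.mono (B := ⋃₀ (F '' c) ∪ ⋃₀ ((fun p => {p}) '' s)) (SmallS.union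
        (small_of_countable (hc.image _) ?_) (small_of_countable (hs.image _) ?_)) ?_
      · rintro _ ⟨d, -, rfl⟩; exact hF d
      · rintro _ ⟨d, -, rfl⟩; exact UC_singleton d
      · intro p hp
        by_cases h : ∀ i ∈ c, p ∉ F i
        · exact Or.inr ⟨{p}, ⟨p, hcon p hp h, rfl⟩, rfl⟩
        · push Not at h
          obtain ⟨i, hi, hpi⟩ := h
          exact Or.inl ⟨F i, ⟨i, hi, rfl⟩, hpi⟩)
  refine ⟨E, ?_, fun d v => ⟨T d v, hE2 (d, v), hT2 d v⟩⟩
  rintro _ ⟨d, rfl⟩ h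
  have := hE1 d
  simp only [F, if_pos h] at this
  exact this

end Aux

/-- Assuming CH, there is a set `E` in the Hilbert cube `[0,1]^ℕ` of cardinality `𝔠` such
that some continuous `f : E → [0,1]^ℕ` is not uniformly continuous on any subset of `E`
of cardinality `𝔠`, yet every continuous `g : E → ℝ` attains some value on a subset of `E`
of cardinality `𝔠`. -/
theorem stmt_11 (CH : continuum = aleph 1) :
    ∃ E : Set (ℕ → unitInterval), #E = continuum ∧
      (∃ f : E → (ℕ → unitInterval), Continuous f ∧
        ∀ A : Set E, #A = continuum → ¬ UniformContinuousOn f A) ∧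
      ∀ g : E → ℝ, Continuous g → ∃ r : ℝ, #{x : E | g x = r} = continuum := by
  have CH0 : (continuum : Cardinal.{0}) = aleph 1 := by
    apply Cardinal.lift_injective
    rw [Cardinal.lift_continuum, CH, Cardinal.lift_aleph]
    simp
  obtain ⟨E', hE1, hE2⟩ := exists_E CH0
  let E : Set (ℕ → unitInterval) := Subtype.val '' E'
  have hpos : ∀ e : E, ∀ n, 0 < (e.1 n : ℝ) := by
    rintro ⟨_, p, hp, rfl⟩; exact p.2
  let c : E → PP := fun e => ⟨e.1, hpos e⟩
  have hcE : ∀ e, c e ∈ E' := by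
    rintro ⟨_, p, hp, rfl⟩; exact hp
  have hcc : Continuous c := Continuous.subtype_mk continuous_subtype_val _
  have hci : Function.Injective c := fun x y h => Subtype.ext (congrArg (fun z : PP => z.1) h)
  have hind : Topology.IsInducing c :=
    Topology.IsInducing.of_comp hcc continuous_subtype_val Topology.IsInducing.subtypeVal
  have hcs : ∀ p ∈ E', ∃ e, c e = p := fun p hp => ⟨⟨p.1, p, hp, rfl⟩, rfl⟩
  have hEle : #E ≤ continuum := (Cardinal.mk_le_of_injective hci).trans mk_PP_le
  have hbig : ∀ B : Set E, ¬ B.Countable → #B = continuum := by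
    intro B hB
    refine le_antisymm ((mk_subtype_le _).trans hEle) ?_
    rw [CH0]
    by_contra h
    exact hB (Cardinal.le_aleph0_iff_set_countable.1 (Cardinal.lt_aleph_one_iff.1 (not_le.1 h)))
  have hcu : ∀ T : Set PP, ¬ (E' ∩ T).Countable → ¬ (c ⁻¹' T).Countable := by
    intro T hT h
    refine hT ((h.image c).mono ?_)
    rintro p ⟨hp, hpT⟩
    obtain ⟨e, rfl⟩ := hcs p hp
    exact ⟨e, hpT, rfl⟩
  have hEu : ¬ (Set.univ : Set E).Countable := by
    obtain ⟨T, hT, -⟩ := hE2 (fun _ => onePP) (fun _ => 0)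
    exact fun h => hcu T hT (h.mono (Set.subset_univ _))
  have hne : Nonempty E := by
    by_contra hne
    rw [not_nonempty_iff] at hne
    exact hEu (Set.to_countable _)
  refine ⟨E, ?_, ?_, ?_⟩
  · rw [← Cardinal.mk_univ]; exact hbig _ hEu
  · have hps : ∀ s : ℝ, psi s ∈ unitInterval := fun s =>
      ⟨sq_nonneg _, Real.sin_sq_le_one _⟩
    refine ⟨fun e n => ⟨psi (e.1 n), hps _⟩, ?_, ?_⟩
    · refine continuous_pi fun n => Continuous.subtype_mk ?_ _
      have h := (psi_cont n).comp hcc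
      exact h
    · intro A hA hf
      have hAne : A.Nonempty := by
        rw [Set.nonempty_iff_ne_empty]
        rintro rfl
        rw [Cardinal.mk_emptyCollection] at hA
        exact continuum_ne_zero hA.symm
      have : Nonempty A := hAne.to_subtype
      let d : ℕ → PP := fun k => c (TopologicalSpace.denseSeq A k).1
      have hmod : ∀ n : ℕ, ∃ (N : ℕ) (δ : ℝ), 0 < δ ∧ ∀ x ∈ A, ∀ y ∈ A,
          (∀ i < N, |(x.1 i : ℝ) - y.1 i| < δ) → |psi (x.1 n) - psi (y.1 n)| ≤ 1 / 2 := by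
        intro n
        have hV : {z : (ℕ → unitInterval) × (ℕ → unitInterval) | dist (z.1 n) (z.2 n) < 1/2} ∈
            uniformity (ℕ → unitInterval) := by
          rw [Pi.uniformity]
          exact Filter.mem_iInf_of_mem n (Filter.preimage_mem_comap
            (Metric.dist_mem_uniformity (by norm_num)))
        have h := hf hV
        rw [Filter.mem_map, Filter.mem_inf_principal, uniformity_subtype] at h
        obtain ⟨W, hW, hWs⟩ := h
        obtain ⟨N, δ, hδ, h⟩ := unif_aux W hW
        refine ⟨N, δ, hδ, fun x hx y hy hxy => ?_⟩
        have h1 : ((x, y) : E × E) ∈ _ := hWs (show (x.1, y.1) ∈ W from h _ _ hxy)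
        have h2 := h1 ⟨hx, hy⟩
        exact le_of_lt h2
      have hUC : UC (closure (Set.range d)) := by
        apply UC_closure
        intro n
        obtain ⟨N, δ, hδ, h⟩ := hmod n
        refine ⟨N, δ, hδ, ?_⟩
        rintro _ ⟨k, rfl⟩ _ ⟨l, rfl⟩ hkl
        exact h _ (TopologicalSpace.denseSeq A k).2 _ (TopologicalSpace.denseSeq A l).2 hkl
      have hcount := hE1 _ ⟨d, rfl⟩ hUC
      have hsub : A ⊆ c ⁻¹' (E' ∩ closure (Set.range d)) := by
        intro e he
        refine ⟨hcE e, ?_⟩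
        have h1 : (⟨e, he⟩ : A) ∈ closure (Set.range (TopologicalSpace.denseSeq A)) :=
          TopologicalSpace.denseRange_denseSeq A _
        have h2 : Continuous fun a : A => c a.1 := hcc.comp continuous_subtype_val
        have h3 := image_closure_subset_closure_image h2 (Set.mem_image_of_mem _ h1)
        rw [← Set.range_comp] at h3
        exact h3
      have hAc : A.Countable := (hcount.preimage hci).mono hsub
      have := Cardinal.le_aleph0_iff_set_countable.2 hAc
      rw [hA] at this
      exact absurd this (not_le.2 aleph0_lt_continuum)
  · intro g hg
    let d0 := TopologicalSpace.denseSeq E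
    obtain ⟨T, hT, hT'⟩ := hE2 (c ∘ d0) (g ∘ d0)
    have hcomap : ∀ e, Filter.comap (c ∘ d0) (nhds (c e)) = Filter.comap d0 (nhds e) := by
      intro e
      rw [← Filter.comap_comap, ← hind.nhds_eq_comap]
    have hnb : ∀ e, (Filter.comap d0 (nhds e)).NeBot := by
      intro e
      rw [Filter.comap_neBot_iff]
      intro t ht
      obtain ⟨k, hk⟩ := (TopologicalSpace.denseRange_denseSeq E).exists_mem_open
        isOpen_interior ⟨e, mem_interior_iff_mem_nhds.2 ht⟩
      exact ⟨k, interior_subset hk⟩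
    have hlim : ∀ e, Filter.Tendsto (g ∘ d0) (Filter.comap (c ∘ d0) (nhds (c e))) (nhds (g e)) := by
      intro e
      rw [hcomap]
      exact (hg.tendsto e).comp Filter.tendsto_comap
    have hdom : ∀ e, c e ∈ Dom (c ∘ d0) (g ∘ d0) := fun e =>
      ⟨by rw [hcomap]; exact hnb e, g e, hlim e⟩
    have hext : ∀ e, ExtF (c ∘ d0) (g ∘ d0) (c e) = g e := by
      intro e
      have : (Filter.comap (c ∘ d0) (nhds (c e))).NeBot := (hdom e).1
      exact (hlim e).limUnder_eq
    have hTu := hcu T hT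
    rcases hT' with rfl | ⟨r, rfl⟩
    · exfalso
      apply hTu
      have : c ⁻¹' (Dom (c ∘ d0) (g ∘ d0))ᶜ = ∅ := by
        ext e; simp only [Set.mem_preimage, Set.mem_compl_iff, Set.mem_empty_iff_false, iff_false,
          not_not]
        exact hdom e
      rw [this]; exact Set.countable_empty
    · refine ⟨r, hbig _ ?_⟩
      intro h
      refine hTu (h.mono ?_)
      rintro e ⟨-, he⟩
      rw [hext] at he
      exact he
end

section
/- Assume that no family of fewer than 𝔠 meager subsets of ℝ covers ℝ (i.e., cov(ℳ) = 𝔠). Then there exists a set E ⊆ [0,1]^ℕ of cardinality 𝔠 such that: (1) there is a continuous function f : E → [0,1]^ℕ such that for every subset A ⊆ E of cardinality 𝔠, the restriction of f to A is not uniformly continuous; and (2) for every continuous function g : E → ℝ there is r ∈ ℝ such that the set {x ∈ E : g(x) = r} has cardinality 𝔠. -/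
open Cardinal

open Filter Topology

noncomputable def runC (x : ℝ) (n : ℕ) : ℕ := sInf {m : ℕ | ⌊(2:ℝ)^(n+m+1) * x⌋ % 2 = 1}

lemma floor_pow_le (x : ℝ) (i n : ℕ) (h : i ≤ n) :
    ⌊(2:ℝ)^i * x⌋ = ⌊(2:ℝ)^n * x⌋ / ((2^(n-i) : ℕ) : ℤ) := by
  rw [← Int.floor_div_natCast]
  congr 1
  obtain ⟨d, rfl⟩ := Nat.exists_eq_add_of_le h
  simp only [Nat.add_sub_cancel_left]
  push_cast
  rw [pow_add]
  field_simp

lemma runC_congr (x y : ℝ) (n : ℕ) (hxy : ⌊(2:ℝ)^n * x⌋ = ⌊(2:ℝ)^n * y⌋)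
    (hodd : ⌊(2:ℝ)^n * x⌋ % 2 = 1) (j : ℕ) (hj : j < n) : runC x j = runC y j := by
  have key : ∀ i ≤ n, ⌊(2:ℝ)^i * x⌋ = ⌊(2:ℝ)^i * y⌋ := by
    intro i hi
    rw [floor_pow_le x i n hi, floor_pow_le y i n hi, hxy]
  have aux : ∀ x y : ℝ, (∀ i ≤ n, ⌊(2:ℝ)^i * x⌋ = ⌊(2:ℝ)^i * y⌋) → ⌊(2:ℝ)^n * x⌋ % 2 = 1 →
      runC y j ≤ runC x j := by
    intro x y key hodd
    have hmem : n - j - 1 ∈ {m : ℕ | ⌊(2:ℝ)^(j+m+1) * x⌋ % 2 = 1} := by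
      have : j + (n - j - 1) + 1 = n := by omega
      simp only [Set.mem_ofPred_eq, this, hodd]
    have h1 := Nat.sInf_mem ⟨_, hmem⟩
    have h2 := Nat.sInf_le hmem
    apply Nat.sInf_le
    simp only [Set.mem_ofPred_eq] at h1 ⊢
    rw [← key _ (by unfold runC; omega)]
    exact h1
  exact le_antisymm (aux y x (fun i hi => (key i hi).symm) (by rw [← hxy]; exact hodd))
    (aux x y key hodd)

lemma runC_eq (x : ℝ) (n m : ℕ) (k : ℤ) (h : ⌊(2:ℝ)^(n+m+1) * x⌋ = k * 2^(m+1) + 1) :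
    runC x n = m := by
  apply le_antisymm
  · apply Nat.sInf_le
    simp only [Set.mem_ofPred_eq, h]
    rw [pow_succ, ← mul_assoc]; omega
  · apply le_csInf
    · refine ⟨m, ?_⟩
      simp only [Set.mem_ofPred_eq, h]
      rw [pow_succ, ← mul_assoc]; omega
    · intro l hl
      by_contra hlt
      push Not at hlt
      simp only [Set.mem_ofPred_eq] at hl
      rw [floor_pow_le x (n+l+1) (n+m+1) (by omega), h] at hl
      have e1 : n + m + 1 - (n+l+1) = m - l := by omega
      have e2 : (k * 2^(m+1) + 1 : ℤ) = 1 + (k * 2^(l+1)) * ((2^(m-l) : ℕ) : ℤ) := by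
        push_cast
        rw [mul_assoc, ← pow_add, add_comm]
        congr 3; omega
      rw [e1, e2, Int.add_mul_ediv_right _ _ (by positivity)] at hl
      have e3 : (1:ℤ) / ((2^(m-l) : ℕ) : ℤ) = 0 := by
        apply Int.ediv_eq_zero_of_lt (by norm_num)
        exact_mod_cast Nat.one_lt_two_pow (by omega)
      rw [e3, pow_succ, ← mul_assoc] at hl
      omega

lemma runC_generic (U : Set ℝ) (hU : IsOpen U) (hne : U.Nonempty) (N : ℕ) :
    ∃ n ≥ N, ∃ v : ℕ → ℕ, ∀ m : ℕ, ∃ V : Set ℝ, IsOpen V ∧ V.Nonempty ∧ V ⊆ U ∧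
      ∀ x ∈ V, (∀ j < n, runC x j = v j) ∧ runC x n = m := by
  obtain ⟨x0, hx0⟩ := hne
  obtain ⟨ε, hε, hball⟩ := Metric.isOpen_iff.1 hU x0 hx0
  obtain ⟨p, hp⟩ := exists_pow_lt_of_lt_one (show 0 < ε/2 by positivity) (show (1/2:ℝ) < 1 by norm_num)
  set n := p + N + 1 with hn
  have hpn : (1/2:ℝ)^(p+N) < ε/2 :=
    lt_of_le_of_lt (pow_le_pow_of_le_one (by norm_num) (by norm_num) (by omega)) hp
  set k : ℤ := 2 * ⌊(2:ℝ)^(p+N) * x0⌋ + 1 with hk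
  have P0 : (0:ℝ) < 2^(p+N) := by positivity
  have hinv : (1/2:ℝ)^(p+N) * 2^(p+N) = 1 := by rw [← mul_pow]; norm_num
  have hsub : ∀ x : ℝ, ⌊(2:ℝ)^n * x⌋ = k → x ∈ U := by
    intro x hx
    apply hball
    rw [Int.floor_eq_iff] at hx
    have h1 := Int.floor_le ((2:ℝ)^(p+N) * x0)
    have h2 := Int.lt_floor_add_one ((2:ℝ)^(p+N) * x0)
    rw [hk, hn, pow_succ] at hx
    push_cast at hx
    rw [Metric.mem_ball, Real.dist_eq, abs_lt]
    constructor
    · by_contra hcon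
      push Not at hcon
      nlinarith
    · by_contra hcon
      push Not at hcon
      nlinarith
  refine ⟨n, by omega, fun j => runC ((k:ℝ) / 2^n) j, fun m => ?_⟩
  have hfl : ⌊(2:ℝ)^n * ((k:ℝ) / 2^n)⌋ = k := by
    rw [mul_div_cancel₀ _ (by positivity)]; simp
  set l : ℤ := k * 2^(m+1) + 1 with hl
  have Q0 : (0:ℝ) < 2^(n+m+1) := by positivity
  refine ⟨Set.Ioo ((l:ℝ)/2^(n+m+1)) ((l+1:ℝ)/2^(n+m+1)), isOpen_Ioo, ?_, ?_⟩
  · rw [Set.nonempty_Ioo]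
    gcongr; linarith
  have hfl2 : ∀ x ∈ Set.Ioo ((l:ℝ)/2^(n+m+1)) ((l+1:ℝ)/2^(n+m+1)), ⌊(2:ℝ)^(n+m+1) * x⌋ = l := by
    intro x hx
    rw [Set.mem_Ioo, div_lt_iff₀ Q0, lt_div_iff₀ Q0] at hx
    rw [Int.floor_eq_iff]
    constructor <;> linarith
  have hfl3 : ∀ x ∈ Set.Ioo ((l:ℝ)/2^(n+m+1)) ((l+1:ℝ)/2^(n+m+1)), ⌊(2:ℝ)^n * x⌋ = k := by
    intro x hx
    rw [floor_pow_le x n (n+m+1) (by omega), hfl2 x hx, hl]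
    have : n + m + 1 - n = m + 1 := by omega
    rw [this, add_comm]
    push_cast
    rw [Int.add_mul_ediv_right _ _ (by positivity)]
    have e3 : (1:ℤ) / (2^(m+1)) = 0 := by
      apply Int.ediv_eq_zero_of_lt (by norm_num)
      exact_mod_cast Nat.one_lt_two_pow (by omega)
    rw [e3]; simp
  refine ⟨fun x hx => hsub x (hfl3 x hx), fun x hx => ⟨fun j hj => ?_, ?_⟩⟩
  · apply runC_congr x _ n _ _ j hj
    · rw [hfl3 x hx, hfl]
    · rw [hfl3 x hx]; omega
  · exact runC_eq x n m k (by rw [hfl2 x hx])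


lemma transfinite_pick {Y I P : Type} (hI : #I ≤ continuum) (hP : #P ≤ continuum) [Nonempty P]
    (B : I → Set Y) (hsing : ∀ y, ∃ i, y ∈ B i) (Z : P → Set Y)
    (hZ : ∀ p, ∀ S : Set I, #S < continuum → ∃ y ∈ Z p, ∀ i ∈ S, y ∉ B i) :
    ∃ Y0 : Set Y, (∀ p, continuum ≤ #(Y0 ∩ Z p : Set Y)) ∧
      ∀ i, #(Y0 ∩ B i : Set Y) < continuum := by
  classical
  let κ := (continuum.{0}).ord.ToType
  have hκ : #κ = continuum := by simp [κ]
  have hlt : ∀ a : κ, #(Set.Iio a) < continuum := fun a => mk_Iio_toType_ord_lt a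
  have hle : ∀ a : κ, #(Set.Iic a) < continuum := by
    intro a
    rw [← Set.Iio_insert]
    refine (mk_insert_le).trans_lt ?_
    exact add_lt_of_lt aleph0_le_continuum (hlt a) (one_lt_aleph0.trans_le aleph0_le_continuum)
  obtain ⟨p0⟩ := ‹Nonempty P›
  obtain ⟨y0, hy0, -⟩ := hZ p0 ∅ (by simp [continuum_pos])
  haveI : Nonempty I := ⟨(hsing y0).choose⟩
  haveI : Nonempty P := ⟨p0⟩
  have hprod : #(P × κ) = #κ := by
    rw [mk_prod, lift_id, lift_id, hκ]
    exact mul_eq_right aleph0_le_continuum hP (mk_ne_zero P)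
  obtain ⟨pe⟩ := Cardinal.eq.1 hprod.symm
  rw [← hκ] at hI
  obtain ⟨ie⟩ := hI
  let idx : κ → I := Function.invFun ie
  have hidx : Function.Surjective idx := Function.invFun_surjective ie.injective
  choose sg hsg using hsing
  let S : ∀ a : κ, (∀ b, b < a → Y) → Set I := fun a g =>
    idx '' Set.Iic a ∪ Set.range (fun b : Set.Iio a => sg (g b.1 b.2))
  have hS : ∀ a g, #(S a g) < continuum := by
    intro a g
    refine (mk_union_le _ _).trans_lt (add_lt_of_lt aleph0_le_continuum ?_ ?_)
    · exact mk_image_le.trans_lt (hle a)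
    · exact mk_range_le.trans_lt (hlt a)
  let step : ∀ a : κ, (∀ b, b < a → Y) → Y := fun a g => (hZ (pe a).1 (S a g) (hS a g)).choose
  have hstep : ∀ a g, step a g ∈ Z (pe a).1 ∧ ∀ i ∈ S a g, step a g ∉ B i := fun a g =>
    (hZ (pe a).1 (S a g) (hS a g)).choose_spec
  let y : κ → Y := (wellFounded_lt (α := κ)).fix step
  have hy : ∀ a, y a = step a (fun b _ => y b) := fun a => WellFounded.fix_eq _ _ _
  have hyZ : ∀ a, y a ∈ Z (pe a).1 := fun a => by rw [hy]; exact (hstep a (fun b _ => y b)).1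
  have hyB : ∀ a b, b ≤ a → y a ∉ B (idx b) := by
    intro a b hb
    rw [hy]
    exact (hstep a (fun b _ => y b)).2 _ (Or.inl ⟨b, hb, rfl⟩)
  have hne : ∀ a b, b < a → y a ≠ y b := by
    intro a b hb h
    have h1 := (hstep a (fun b _ => y b)).2 (sg (y b)) (Or.inr ⟨⟨b, hb⟩, rfl⟩)
    rw [← hy, h] at h1
    exact h1 (hsg _)
  have hinj : Function.Injective y := by
    intro a b h
    rcases lt_trichotomy a b with h1 | h1 | h1
    · exact absurd h.symm (hne _ _ h1)
    · exact h1
    · exact absurd h (hne _ _ h1)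
  refine ⟨Set.range y, fun p => ?_, fun i => ?_⟩
  · rw [← hκ]
    refine mk_le_of_injective (f := fun k : κ => (⟨y (pe.symm (p, k)), ⟨_, rfl⟩, ?_⟩ :
      (Set.range y ∩ Z p : Set Y))) ?_
    · have := hyZ (pe.symm (p, k))
      simpa using this
    · intro k l h
      have := hinj (Subtype.ext_iff.1 h)
      simpa using this
  · obtain ⟨a, rfl⟩ := hidx i
    refine (mk_le_mk_of_subset (t := y '' Set.Iio a) ?_).trans_lt (mk_image_le.trans_lt (hlt a))
    rintro _ ⟨⟨b, rfl⟩, hb⟩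
    refine ⟨b, ?_, rfl⟩
    by_contra h
    exact hyB b a (not_lt.1 h) hb

noncomputable def sgm (y : ℕ → ℂ) (n : ℕ) : ℝ := ∏ j ∈ Finset.range (n+1), (1 + ‖y j‖)⁻¹

noncomputable def ec (y : ℕ → ℂ) (k : ℕ) : ℝ :=
  if k % 3 = 0 then sgm y (k/3) else
  if k % 3 = 1 then sgm y (k/3) ^ 2 * (y (k/3)).re else sgm y (k/3) ^ 2 * (y (k/3)).im

noncomputable def uu (z : ℂ) : ℂ := z / ((1 + ‖z‖ : ℝ) : ℂ)

def Bad (B : Set (ℕ → ℂ)) : Prop := ∀ n : ℕ, ∃ δ > 0, ∃ K : ℕ, ∀ x ∈ B, ∀ y ∈ B,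
  (∀ k < K, |ec x k - ec y k| < δ) → ‖uu (x n) - uu (y n)‖ ≤ 1/4

lemma sgm_pos (y : ℕ → ℂ) (n : ℕ) : 0 < sgm y n :=
  Finset.prod_pos fun _ _ => by positivity

lemma one_add_inv_le (z : ℂ) : (1 + ‖z‖)⁻¹ ≤ 1 := inv_le_one_of_one_le₀ (by linarith [norm_nonneg z])

lemma sgm_le (y : ℕ → ℂ) (n i : ℕ) (h : n ≤ i) : sgm y i ≤ (1 + ‖y n‖)⁻¹ := by
  unfold sgm
  rw [← Finset.mul_prod_erase _ _ (Finset.mem_range.2 (show n < i + 1 by omega))]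
  refine mul_le_of_le_one_right (by positivity) ?_
  exact Finset.prod_le_one (fun _ _ => by positivity) (fun _ _ => one_add_inv_le _)

lemma sgm_le_one (y : ℕ → ℂ) (n : ℕ) : sgm y n ≤ 1 :=
  (sgm_le y n n le_rfl).trans (one_add_inv_le _)

lemma abs_ec_le (y : ℕ → ℂ) (k : ℕ) : |ec y k| ≤ sgm y (k/3) := by
  have h0 := sgm_pos y (k/3)
  have h1 := sgm_le y (k/3) (k/3) le_rfl
  have h2 : sgm y (k/3) * ‖y (k/3)‖ ≤ 1 := by
    calc _ ≤ (1 + ‖y (k/3)‖)⁻¹ * ‖y (k/3)‖ := by gcongr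
      _ ≤ 1 := by
        rw [inv_mul_le_iff₀ (by positivity)]; linarith
  have h3 : ∀ r : ℝ, |r| ≤ ‖y (k/3)‖ → |sgm y (k/3)^2 * r| ≤ sgm y (k/3) := by
    intro r hr
    rw [abs_mul, abs_of_pos (by positivity), pow_two, mul_assoc]
    refine mul_le_of_le_one_right h0.le (le_trans ?_ h2)
    gcongr
  unfold ec
  split_ifs
  · rw [abs_of_pos h0]
  · exact h3 _ (Complex.abs_re_le_norm _)
  · exact h3 _ (Complex.abs_im_le_norm _)

lemma sgm_congr (x y : ℕ → ℂ) (n : ℕ) (h : ∀ j ≤ n, x j = y j) : sgm x n = sgm y n := by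
  unfold sgm
  refine Finset.prod_congr rfl fun j hj => ?_
  rw [h j (by simpa [Nat.lt_succ_iff] using hj)]

lemma ec_congr (x y : ℕ → ℂ) (k : ℕ) (h : ∀ j ≤ k/3, x j = y j) : ec x k = ec y k := by
  unfold ec
  rw [sgm_congr x y _ h, h _ le_rfl]

lemma sgm_cont (n : ℕ) : Continuous (fun y => sgm y n) := by
  unfold sgm
  refine continuous_finsetProd _ fun j _ => ?_
  exact Continuous.inv₀ (by fun_prop) (fun y => by positivity)

lemma ec_cont (k : ℕ) : Continuous (fun y => ec y k) := by
  have := sgm_cont (k/3)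
  unfold ec
  split_ifs
  · exact this
  · exact (this.pow 2).mul (Complex.continuous_re.comp (continuous_apply _))
  · exact (this.pow 2).mul (Complex.continuous_im.comp (continuous_apply _))

lemma uu_cont : Continuous uu := by
  unfold uu
  refine continuous_id.div (by fun_prop) (fun z => ?_)
  exact_mod_cast (by positivity : (1 + ‖z‖ : ℝ) ≠ 0)

/-- The generic path. -/
noncomputable def qs : ℕ → C(unitInterval, ℂ) := TopologicalSpace.denseSeq _

noncomputable def bump (m : ℕ) (t : ℝ) : ℂ :=
  ((t * (1 - t) : ℝ) : ℂ) * qs m (Set.projIcc 0 1 zero_le_one t)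

noncomputable def gpath (a b : ℕ → ℂ) (N : ℕ) (c : ℕ → ℕ) (t : ℝ) (n : ℕ) : ℂ :=
  ((1 - t : ℝ) : ℂ) * a n + (t : ℂ) * b n + (if n < N then 0 else bump (c n) t)

lemma bump_cont (m : ℕ) : Continuous (bump m) := by
  unfold bump
  have : Continuous (Set.projIcc (0:ℝ) 1 zero_le_one) := continuous_projIcc
  fun_prop

lemma gpath_cont (a b : ℕ → ℂ) (N : ℕ) (c : ℕ → ℕ) : Continuous (gpath a b N c) := by
  refine continuous_pi fun n => ?_
  unfold gpath
  have := bump_cont (c n)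
  split_ifs <;> fun_prop


lemma avoid_rel (R : ℝ → Set ℂ)
    (hR : ∀ t : ℝ, ∃ O ∈ 𝓝 t, ∀ s ∈ O, ∀ s' ∈ O, ∀ u ∈ R s, ∀ u' ∈ R s', ‖u - u'‖ ≤ 1/4) :
    ∃ w : ℝ → ℂ, Continuous w ∧ (∀ t, ‖w t‖ = 1) ∧ ∀ t, ∀ u ∈ R t, 5/8 ≤ ‖w t - u‖ := by
  obtain ⟨P, hP⟩ := exists_contMDiffMap_forall_mem_convex_of_local_const (n := 1)
    (modelWithCornersSelf ℝ ℝ) (M := ℝ) (F := ℂ)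
    (t := fun t => ⋂ u ∈ R t, Metric.closedBall u (1/4))
    (fun t => convex_iInter₂ fun u _ => convex_closedBall u _) (by
      intro t
      obtain ⟨O, hO, h⟩ := hR t
      by_cases hne : ∃ s ∈ O, (R s).Nonempty
      · obtain ⟨s, hs, u, hu⟩ := hne
        refine ⟨u, ?_⟩
        filter_upwards [hO] with s' hs'
        simp only [Set.mem_iInter, Metric.mem_closedBall, dist_eq_norm]
        intro u' hu'
        exact h s hs s' hs' u hu u' hu'
      · refine ⟨0, ?_⟩
        filter_upwards [hO] with s' hs'
        simp only [Set.mem_iInter]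
        intro u' hu'
        exact absurd ⟨s', hs', u', hu'⟩ hne)
  have hPd : ContDiff ℝ 1 (P : ℝ → ℂ) := contMDiff_iff_contDiff.1 P.contMDiff
  have hdense := hPd.dense_compl_range_of_finrank_lt_finrank (by simp [Complex.finrank_real_complex])
  obtain ⟨z, hz, hz2⟩ := Metric.dense_iff.1 hdense 0 (1/8) (by norm_num)
  have hne : ∀ t, P t - z ≠ 0 := fun t h => hz2 ⟨t, sub_eq_zero.1 h⟩
  have hz3 : ‖z‖ < 1/8 := by simpa using hz
  have hPc : Continuous (P : ℝ → ℂ) := hPd.continuous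
  refine ⟨fun t => -((‖P t - z‖⁻¹ : ℝ) : ℂ) * (P t - z), ?_, ?_, ?_⟩
  · refine Continuous.mul (Continuous.neg (Complex.continuous_ofReal.comp ?_)) (by fun_prop)
    exact Continuous.inv₀ (by fun_prop) fun t => norm_ne_zero_iff.2 (hne t)
  · intro t
    have := norm_ne_zero_iff.2 (hne t)
    rw [norm_mul, norm_neg, Complex.norm_real, norm_inv, norm_norm, inv_mul_cancel₀ this]
  · intro t u hu
    have h1 := hP t
    simp only [Set.mem_iInter, Metric.mem_closedBall, dist_eq_norm] at h1
    have h2 := h1 u hu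
    have hn := norm_pos_iff.2 (hne t)
    have h3 : (1:ℝ) ≤ ‖-((‖P t - z‖⁻¹ : ℝ) : ℂ) * (P t - z) - (P t - z)‖ := by
      have : -((‖P t - z‖⁻¹ : ℝ) : ℂ) * (P t - z) - (P t - z)
        = ((-(‖P t - z‖⁻¹ + 1) : ℝ) : ℂ) * (P t - z) := by push_cast; ring
      rw [this, norm_mul, Complex.norm_real, Real.norm_eq_abs, abs_neg, abs_of_pos (by positivity),
        add_mul, inv_mul_cancel₀ hn.ne']
      linarith
    have h4 : -((‖P t - z‖⁻¹ : ℝ) : ℂ) * (P t - z) - (P t - z) =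
      (-((‖P t - z‖⁻¹ : ℝ) : ℂ) * (P t - z) - u) - (P t - u) + z := by ring
    have h5 := norm_add_le ((-((‖P t - z‖⁻¹ : ℝ) : ℂ) * (P t - z) - u) - (P t - u)) z
    have h6 := norm_sub_le (-((‖P t - z‖⁻¹ : ℝ) : ℂ) * (P t - z) - u) (P t - u)
    rw [← h4] at h5
    linarith

lemma uu_near (w y : ℂ) (L : ℝ) (hL : 6 ≤ L) (hw : ‖w‖ = 1) (h : ‖y - L * w‖ ≤ 1) :
    ‖w - uu y‖ ≤ 1/2 := by
  have hLw : ‖(L:ℂ) * w‖ = L := by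
    rw [norm_mul, hw, Complex.norm_real, Real.norm_eq_abs, abs_of_pos (by linarith)]; ring
  have h1 := abs_norm_sub_norm_le y (L * w)
  rw [hLw, abs_le] at h1
  have hp : (0:ℝ) < 1 + ‖y‖ := by positivity
  have hpc : ((1 + ‖y‖ : ℝ) : ℂ) ≠ 0 := by exact_mod_cast hp.ne'
  have e : w - uu y = (((1 + ‖y‖ - L : ℝ) : ℂ) * w - (y - L * w)) / ((1 + ‖y‖ : ℝ) : ℂ) := by
    unfold uu
    field_simp
    push_cast
    ring
  have h2 : ‖((1 + ‖y‖ - L : ℝ) : ℂ) * w‖ ≤ 2 := by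
    rw [norm_mul, hw, Complex.norm_real, Real.norm_eq_abs, mul_one, abs_le]
    constructor <;> linarith
  rw [e, norm_div, Complex.norm_real, Real.norm_eq_abs, abs_of_pos hp, div_le_iff₀ hp]
  have := norm_sub_le (((1 + ‖y‖ - L : ℝ) : ℂ) * w) (y - L * w)
  linarith

lemma path_avoid (B : Set (ℕ → ℂ)) (hB : Bad B) (a b : ℕ → ℂ) (N : ℕ) (τ : ℝ) (hτ : 0 < τ)
    (U : Set ℝ) (hU : IsOpen U) (hne : U.Nonempty) :
    ∃ V : Set ℝ, IsOpen V ∧ V.Nonempty ∧ V ⊆ U ∧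
      ∀ x ∈ V, ∀ t, τ ≤ t → t ≤ 1 - τ → gpath a b N (runC x) t ∉ B := by
  obtain ⟨n, hn, v, hv⟩ := runC_generic U hU hne N
  obtain ⟨δ, hδ, K, hK⟩ := hB n
  set η := gpath a b N v with hη
  have hηc : Continuous η := gpath_cont a b N v
  set M : ℝ := 2/δ + 1 with hM
  have hM0 : 0 < M := by positivity
  have hMδ : (1 + M)⁻¹ < δ/2 := by
    rw [inv_lt_comm₀ (by positivity) (by positivity), hM, inv_div]; linarith
  obtain ⟨w, hwc, hw1, hw⟩ := avoid_rel (fun t => {u | ∃ x ∈ B, (∀ j < n, x j = η t j) ∧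
      M ≤ ‖x n‖ ∧ u = uu (x n)}) (by
    intro t
    refine ⟨{s | ∀ k < 3 * n, |ec (η s) k - ec (η t) k| < δ/2}, ?_, ?_⟩
    · have : ∀ᶠ s in 𝓝 t, ∀ k ∈ Finset.range (3*n), |ec (η s) k - ec (η t) k| < δ/2 := by
        rw [Filter.eventually_all_finset]
        intro k _
        have hc : Continuous (fun s => |ec (η s) k - ec (η t) k|) :=
          (((ec_cont k).comp hηc).sub continuous_const).abs
        apply hc.continuousAt.eventually_lt continuousAt_const
        simpa using hδ
      filter_upwards [this] with s hs k hk using hs k (Finset.mem_range.2 hk)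
    · rintro s hs s' hs' _ ⟨x, hx, hxj, hxM, rfl⟩ _ ⟨x', hx', hxj', hxM', rfl⟩
      apply hK x hx x' hx'
      intro k _
      by_cases hk : k < 3 * n
      · have h1 := hs k hk
        have h2 := hs' k hk
        rw [ec_congr x (η s) k (fun j hj => hxj j (by omega)),
          ec_congr x' (η s') k (fun j hj => hxj' j (by omega))]
        rw [abs_lt] at *
        constructor <;> linarith
      · have key : ∀ y : ℕ → ℂ, M ≤ ‖y n‖ → |ec y k| < δ/2 := by
          intro y hy
          refine (abs_ec_le y k).trans_lt ((sgm_le y n _ (by omega)).trans_lt (lt_of_le_of_lt ?_ hMδ))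
          gcongr
        have h1 := key x hxM
        have h2 := key x' hxM'
        rw [abs_lt] at *
        constructor <;> linarith)
  set L : ℝ := M + 6 with hL
  -- target
  let Q : C(unitInterval, ℂ) := ⟨fun t => ((max ((t:ℝ) * (1 - t)) (τ^2) : ℝ) : ℂ)⁻¹ *
    (L * w t - (((1 - t : ℝ) : ℂ) * a n + ((t:ℝ) : ℂ) * b n)), by
      refine Continuous.mul (Continuous.inv₀ (by fun_prop) fun t => ?_) (by fun_prop)
      have : (0:ℝ) < max ((t:ℝ) * (1 - t)) (τ^2) := lt_max_of_lt_right (by positivity)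
      exact_mod_cast this.ne'⟩
  obtain ⟨m, hm⟩ := (TopologicalSpace.denseRange_denseSeq C(unitInterval, ℂ)).exists_dist_lt Q
    (ε := 1) one_pos
  obtain ⟨V, hVo, hVne, hVU, hV⟩ := hv m
  refine ⟨V, hVo, hVne, hVU, fun x hx t ht1 ht2 hB' => ?_⟩
  obtain ⟨hxj, hxn⟩ := hV x hx
  have htI : t ∈ Set.Icc (0:ℝ) 1 := ⟨by linarith, by linarith⟩
  have hprod : τ^2 ≤ t * (1 - t) := by nlinarith
  have hpos : 0 < t * (1 - t) := lt_of_lt_of_le (by positivity) hprod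
  have hle1 : t * (1 - t) ≤ 1 := by nlinarith [sq_nonneg (t - 1)]
  set y := gpath a b N (runC x) t with hy
  have hyn : ‖y n - L * w t‖ ≤ 1 := by
    have h1 : dist (Q ⟨t, htI⟩) (qs m ⟨t, htI⟩) < 1 := (ContinuousMap.dist_apply_le_dist _).trans_lt hm
    have h2 : y n - L * w t = ((t * (1-t) : ℝ) : ℂ) * (qs m ⟨t, htI⟩ - Q ⟨t, htI⟩) := by
      have hc : ((t * (1-t) : ℝ) : ℂ) ≠ 0 := by exact_mod_cast hpos.ne'
      have hQ : ((t * (1-t) : ℝ) : ℂ) * Q ⟨t, htI⟩ =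
          L * w t - (((1 - t : ℝ) : ℂ) * a n + (t : ℂ) * b n) := by
        simp only [Q, ContinuousMap.coe_mk]
        rw [max_eq_left hprod, ← mul_assoc, mul_inv_cancel₀ hc, one_mul]
      rw [mul_sub, hQ, hy]
      simp only [gpath, bump, hxn, if_neg (not_lt.2 hn), Set.projIcc_of_mem zero_le_one htI]
      ring
    rw [h2, norm_mul, Complex.norm_real, Real.norm_eq_abs, abs_of_pos hpos, ← dist_eq_norm, dist_comm]
    nlinarith [dist_nonneg (x := Q ⟨t, htI⟩) (y := qs m ⟨t, htI⟩)]
  have h3 := uu_near (w t) (y n) L (by linarith) (hw1 t) hyn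
  have h4 : M ≤ ‖y n‖ := by
    have hLw : ‖(L:ℂ) * w t‖ = L := by
      rw [norm_mul, hw1, Complex.norm_real, Real.norm_eq_abs, abs_of_pos (by linarith)]; ring
    have h1 := abs_norm_sub_norm_le (y n) (L * w t)
    rw [hLw, abs_le] at h1
    linarith
  have h5 := hw t (uu (y n)) ⟨y, hB', fun j hj => by simp only [hy, hη, gpath, hxj j hj], h4, rfl⟩
  linarith

def CovM : Prop := ∀ S : Set (Set ℝ), (∀ s ∈ S, IsMeagre s) → #S < continuum →
      ⋃₀ S ≠ Set.univ

lemma generic_path (covM : CovM) {I : Type} (B : I → Set (ℕ → ℂ)) (hB : ∀ i, Bad (B i))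
    (S : Set I) (hS : #S < continuum) (a b : ℕ → ℂ) (N : ℕ) :
    ∃ γ : ℝ → ℕ → ℂ, Continuous γ ∧ γ 0 = a ∧ γ 1 = b ∧
      (∀ t, 0 < t → t < 1 → ∀ i ∈ S, γ t ∉ B i) ∧
      ∀ t, ∀ n < N, γ t n = ((1 - t : ℝ) : ℂ) * a n + (t : ℂ) * b n := by
  let W : I → Set ℝ := fun i => {x | ∃ t, 0 < t ∧ t < 1 ∧ gpath a b N (runC x) t ∈ B i}
  have hW : ∀ i, IsMeagre (W i) := by
    intro i
    let W' : ℕ → Set ℝ := fun k => {x | ∃ t, 1/((k:ℝ)+1) ≤ t ∧ t ≤ 1 - 1/((k:ℝ)+1) ∧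
      gpath a b N (runC x) t ∈ B i}
    have h1 : ∀ k, IsMeagre (W' k) := by
      intro k
      apply IsNowhereDense.isMeagre
      rw [IsNowhereDense, ← Set.not_nonempty_iff_eq_empty]
      intro hne
      obtain ⟨V, hVo, ⟨x, hx⟩, hVU, hV⟩ := path_avoid (B i) (hB i) a b N (1/((k:ℝ)+1))
        (by positivity) _ isOpen_interior hne
      obtain ⟨x', hx', t, h1, h2, h3⟩ := mem_closure_iff.1 (interior_subset (hVU hx)) V hVo hx
      exact hV x' hx' t h1 h2 h3
    refine (isMeagre_iUnion h1).mono ?_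
    rintro x ⟨t, h1, h2, h3⟩
    obtain ⟨k, hk⟩ := exists_nat_one_div_lt (lt_min h1 (sub_pos.2 h2))
    rw [lt_min_iff] at hk
    exact Set.mem_iUnion.2 ⟨k, t, by linarith, by linarith, h3⟩
  have hcov := covM (W '' S) (by rintro _ ⟨i, -, rfl⟩; exact hW i) (mk_image_le.trans_lt hS)
  obtain ⟨x, hx⟩ := (Set.ne_univ_iff_exists_notMem _).1 hcov
  refine ⟨gpath a b N (runC x), gpath_cont _ _ _ _, ?_, ?_, ?_, ?_⟩
  · ext n; simp [gpath, bump]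
  · ext n; simp [gpath, bump]
  · intro t h1 h2 i hi h3
    exact hx ⟨W i, ⟨i, hi, rfl⟩, t, h1, h2, h3⟩
  · intro t n hn
    simp [gpath, hn]

lemma generic_point (covM : CovM) {I : Type} (B : I → Set (ℕ → ℂ)) (hB : ∀ i, Bad (B i))
    (S : Set I) (hS : #S < continuum) (a : ℕ → ℂ) (N : ℕ) :
    ∃ c : ℕ → ℂ, (∀ n < N, c n = a n) ∧ ∀ i ∈ S, c ∉ B i := by
  obtain ⟨γ, -, -, -, h1, h2⟩ := generic_path covM B hB S hS a a N
  refine ⟨γ (1/2), fun n hn => ?_, h1 _ (by norm_num) (by norm_num)⟩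
  rw [h2 _ n hn]; push_cast; ring

lemma cyl_nhds (a : ℕ → ℂ) (O : Set (ℕ → ℂ)) (hO : O ∈ 𝓝 a) :
    ∃ N, ∀ c : ℕ → ℂ, (∀ n < N, c n = a n) → c ∈ O := by
  rw [nhds_pi, Filter.mem_pi'] at hO
  obtain ⟨F, t, ht, hsub⟩ := hO
  refine ⟨F.sup id + 1, fun c hc => hsub fun i hi => ?_⟩
  rw [hc i (Nat.lt_succ_of_le (Finset.le_sup (f := id) hi))]
  exact mem_of_mem_nhds (ht i)

lemma no_cross (covM : CovM) {I : Type} (B : I → Set (ℕ → ℂ)) (hB : ∀ i, Bad (B i))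
    (D : Set (ℕ → ℂ)) (h : (ℕ → ℂ) → ℝ) (hc : ContinuousOn h D)
    (S : Set I) (hS : #S < continuum) (hDS : ∀ y, (∀ i ∈ S, y ∉ B i) → y ∈ D)
    (hcovered : ∀ r, ∃ T : Set I, #T < continuum ∧ ∀ y ∈ D, h y = r → ∃ i ∈ T, y ∈ B i)
    (a b : ℕ → ℂ) (ha : a ∈ D) (hb : b ∈ D) (hab : h a < h b) : False := by
  obtain ⟨r, hr1, hr2⟩ := exists_between hab
  obtain ⟨T, hT, hTr⟩ := hcovered r
  have hST : #(S ∪ T : Set I) < continuum :=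
    (mk_union_le _ _).trans_lt (add_lt_of_lt aleph0_le_continuum hS hT)
  have hloc : ∀ a ∈ D, ∀ O : Set ℝ, O ∈ 𝓝 (h a) → ∃ a', a' ∈ D ∧ h a' ∈ O ∧
      ∀ i ∈ S ∪ T, a' ∉ B i := by
    intro a ha O hO
    obtain ⟨O', hO', hsub⟩ := mem_nhdsWithin_iff_exists_mem_nhds_inter.1 (hc a ha hO)
    obtain ⟨N, hN⟩ := cyl_nhds a O' hO'
    obtain ⟨c, hc1, hc2⟩ := generic_point covM B hB (S ∪ T) hST a N
    have hcD : c ∈ D := hDS c fun i hi => hc2 i (Or.inl hi)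
    exact ⟨c, hcD, hsub ⟨hN c hc1, hcD⟩, hc2⟩
  obtain ⟨a', haD, ha1, ha2⟩ := hloc a ha (Set.Iio r) (Iio_mem_nhds hr1)
  obtain ⟨b', hbD, hb1, hb2⟩ := hloc b hb (Set.Ioi r) (Ioi_mem_nhds hr2)
  obtain ⟨γ, hγ, h0, h1, hav, -⟩ := generic_path covM B hB (S ∪ T) hST a' b' 0
  have hav' : ∀ t ∈ Set.Icc (0:ℝ) 1, ∀ i ∈ S ∪ T, γ t ∉ B i := by
    intro t ht
    rcases eq_or_lt_of_le ht.1 with h | h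
    · rw [← h, h0]; exact ha2
    rcases eq_or_lt_of_le ht.2 with h' | h'
    · rw [h', h1]; exact hb2
    exact hav t h h'
  have hγD : Set.MapsTo γ (Set.Icc 0 1) D := fun t ht => hDS _ fun i hi => hav' t ht i (Or.inl hi)
  have hcont : ContinuousOn (h ∘ γ) (Set.Icc 0 1) := hc.comp hγ.continuousOn hγD
  obtain ⟨t, ht, htr⟩ := intermediate_value_Icc zero_le_one hcont
    (show r ∈ Set.Icc ((h ∘ γ) 0) ((h ∘ γ) 1) by
      simp only [Function.comp, h0, h1]; exact ⟨le_of_lt ha1, le_of_lt hb1⟩)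
  obtain ⟨i, hi, hin⟩ := hTr (γ t) (hγD ht) htr
  exact hav' t ht i (Or.inr hi) hin

lemma big_fibre (covM : CovM) {I : Type} (B : I → Set (ℕ → ℂ)) (hB : ∀ i, Bad (B i))
    (D : Set (ℕ → ℂ)) (h : (ℕ → ℂ) → ℝ) (hc : ContinuousOn h D) :
    ∃ Z : Set (ℕ → ℂ), (∀ S : Set I, #S < continuum → ∃ y ∈ Z, ∀ i ∈ S, y ∉ B i) ∧
      (Z = Dᶜ ∨ ∃ r, Z = {y | y ∈ D ∧ h y = r}) := by
  by_contra hcon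
  push Not at hcon
  have h1 : ∃ S : Set I, #S < continuum ∧ ∀ y ∈ Dᶜ, ∃ i ∈ S, y ∈ B i := by
    by_contra hno
    push Not at hno
    exact (hcon Dᶜ hno).1 rfl
  have h2 : ∀ r, ∃ T : Set I, #T < continuum ∧ ∀ y ∈ D, h y = r → ∃ i ∈ T, y ∈ B i := by
    intro r
    by_contra hno
    push Not at hno
    refine (hcon {y | y ∈ D ∧ h y = r} fun S hS => ?_).2 r rfl
    obtain ⟨y, h1, h2, h3⟩ := hno S hS
    exact ⟨y, ⟨h1, h2⟩, h3⟩
  obtain ⟨S, hS, hSD⟩ := h1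
  have hDS : ∀ y, (∀ i ∈ S, y ∉ B i) → y ∈ D := by
    intro y hy
    by_contra hyD
    obtain ⟨i, hi, h⟩ := hSD y hyD
    exact hy i hi h
  obtain ⟨a, -, ha⟩ := generic_point covM B hB S hS 0 0
  obtain ⟨T, hT, hTr⟩ := h2 (h a)
  obtain ⟨b, -, hb⟩ := generic_point covM B hB (S ∪ T)
    ((mk_union_le _ _).trans_lt (add_lt_of_lt aleph0_le_continuum hS hT)) 0 0
  have haD := hDS a ha
  have hbD := hDS b fun i hi => hb i (Or.inl hi)
  rcases lt_trichotomy (h a) (h b) with hlt | heq | hlt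
  · exact no_cross covM B hB D h hc S hS hDS h2 a b haD hbD hlt
  · obtain ⟨i, hi, hin⟩ := hTr b hbD heq.symm
    exact hb i (Or.inr hi) hin
  · exact no_cross covM B hB D h hc S hS hDS h2 b a hbD haD hlt

lemma Bad.closure {A : Set (ℕ → ℂ)} (hA : Bad A) : Bad (closure A) := by
  intro n
  obtain ⟨δ, hδ, K, hK⟩ := hA n
  refine ⟨δ, hδ, K, fun x hx y hy hxy => ?_⟩
  let O : Set ((ℕ → ℂ) × (ℕ → ℂ)) := {p | ∀ k ∈ Finset.range K, |ec p.1 k - ec p.2 k| < δ}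
  have hO : IsOpen O := by
    have : O = ⋂ k ∈ Finset.range K, {p | |ec p.1 k - ec p.2 k| < δ} := by
      ext p; simp [O]
    rw [this]
    refine isOpen_biInter_finset fun k _ => isOpen_lt ?_ continuous_const
    exact (((ec_cont k).comp continuous_fst).sub ((ec_cont k).comp continuous_snd)).abs
  let C : Set ((ℕ → ℂ) × (ℕ → ℂ)) := {p | ‖uu (p.1 n) - uu (p.2 n)‖ ≤ 1/4}
  have hC : IsClosed C := by
    refine isClosed_le ?_ continuous_const
    exact ((uu_cont.comp ((continuous_apply n).comp continuous_fst)).sub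
      (uu_cont.comp ((continuous_apply n).comp continuous_snd))).norm
  have h1 : ((x, y) : (ℕ → ℂ) × (ℕ → ℂ)) ∈ O ∩ _root_.closure (A ×ˢ A) := by
    refine ⟨fun k hk => hxy k (Finset.mem_range.1 hk), ?_⟩
    rw [closure_prod_eq]; exact ⟨hx, hy⟩
  have h2 : O ∩ A ×ˢ A ⊆ C := by
    rintro ⟨x, y⟩ ⟨h, hx, hy⟩
    exact hK x hx y hy fun k hk => h k (Finset.mem_range.2 hk)
  exact closure_minimal h2 hC (hO.inter_closure h1)

lemma Bad.mono {A A' : Set (ℕ → ℂ)} (hA : Bad A) (h : A' ⊆ A) : Bad A' := by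
  intro n
  obtain ⟨δ, hδ, K, hK⟩ := hA n
  exact ⟨δ, hδ, K, fun x hx y hy => hK x (h hx) y (h hy)⟩

lemma exists_seq (A : Set (ℕ → ℂ)) (hA : A.Nonempty) :
    ∃ σ : ℕ → ℕ → ℂ, Set.range σ ⊆ A ∧ A ⊆ closure (Set.range σ) := by
  have : Nonempty A := hA.to_subtype
  refine ⟨fun n => (TopologicalSpace.denseSeq A n : ℕ → ℂ), ?_, ?_⟩
  · rintro _ ⟨n, rfl⟩; exact Subtype.coe_prop _
  · intro x hx
    have h := TopologicalSpace.denseRange_denseSeq A ⟨x, hx⟩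
    have h2 := image_closure_subset_closure_image (f := ((↑) : A → ℕ → ℂ)) continuous_subtype_val
      ⟨_, h, rfl⟩
    rw [← Set.range_comp] at h2
    exact h2

noncomputable def sq01 (r : ℝ) : unitInterval := Set.projIcc 0 1 zero_le_one ((r+1)/2)

lemma sq01_val (r : ℝ) (h : |r| ≤ 1) : (sq01 r : ℝ) = (r+1)/2 := by
  rw [abs_le] at h
  unfold sq01
  rw [Set.projIcc_of_mem zero_le_one (show (r+1)/2 ∈ Set.Icc (0:ℝ) 1 from
    ⟨by linarith, by linarith⟩)]

lemma sq01_cont : Continuous sq01 := continuous_projIcc.comp (by fun_prop)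

lemma sq01_dist (r s : ℝ) (hr : |r| ≤ 1) (hs : |s| ≤ 1) : dist (sq01 r) (sq01 s) = |r - s| / 2 := by
  rw [Subtype.dist_eq, sq01_val r hr, sq01_val s hs, Real.dist_eq]
  rw [show (r+1)/2 - (s+1)/2 = (r-s)/2 by ring, abs_div]; norm_num

noncomputable def emb0 (y : ℕ → ℂ) (k : ℕ) : unitInterval := sq01 (ec y k)

noncomputable def ginv (z : ℕ → unitInterval) (n : ℕ) : ℂ :=
  (((2 * (z (3*n+1) : ℝ) - 1 : ℝ) : ℂ) + ((2 * (z (3*n+2) : ℝ) - 1 : ℝ) : ℂ) * Complex.I) /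
    (((2 * (z (3*n) : ℝ) - 1)^2 : ℝ) : ℂ)

noncomputable def fm (y : ℕ → ℂ) (k : ℕ) : unitInterval :=
  sq01 (if k % 2 = 0 then (uu (y (k/2))).re else (uu (y (k/2))).im)

lemma abs_ec_le_one (y : ℕ → ℂ) (k : ℕ) : |ec y k| ≤ 1 := (abs_ec_le y k).trans (sgm_le_one _ _)

lemma em_val (y : ℕ → ℂ) (k : ℕ) : 2 * (emb0 y k : ℝ) - 1 = ec y k := by
  rw [emb0, sq01_val _ (abs_ec_le_one y k)]; ring

lemma em_cont : Continuous emb0 := continuous_pi fun k => sq01_cont.comp (ec_cont k)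

lemma ginv_em (y : ℕ → ℂ) : ginv (emb0 y) = y := by
  ext n
  unfold ginv
  have h0 : ec y (3*n) = sgm y n := by
    have : 3 * n / 3 = n := by omega
    simp [ec, this]
  have h1 : ec y (3*n+1) = sgm y n ^ 2 * (y n).re := by
    have e1 : (3 * n + 1) / 3 = n := by omega
    have e2 : (3 * n + 1) % 3 = 1 := by omega
    simp [ec, e1, e2]
  have h2 : ec y (3*n+2) = sgm y n ^ 2 * (y n).im := by
    have e1 : (3 * n + 2) / 3 = n := by omega
    have e2 : (3 * n + 2) % 3 = 2 := by omega
    simp [ec, e1, e2]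
  rw [em_val, em_val, em_val, h0, h1, h2]
  have hs : ((sgm y n ^ 2 : ℝ) : ℂ) ≠ 0 := by
    exact_mod_cast (pow_pos (sgm_pos y n) 2).ne'
  rw [div_eq_iff hs]
  conv_rhs => rw [← Complex.re_add_im (y n)]
  push_cast
  ring

lemma ginv_cont (E : Set (ℕ → unitInterval)) (hE : E ⊆ Set.range emb0) :
    Continuous (fun x : E => ginv x.1) := by
  refine continuous_pi fun n => ?_
  unfold ginv
  have hc : ∀ k, Continuous (fun x : E => ((x.1 k : unitInterval) : ℝ)) := fun k =>
    continuous_subtype_val.comp ((continuous_apply k).comp continuous_subtype_val)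
  have hr : ∀ k, Continuous (fun x : E => ((2 * ((x.1 k : unitInterval) : ℝ) - 1 : ℝ) : ℂ)) :=
    fun k => Complex.continuous_ofReal.comp ((continuous_const.mul (hc k)).sub continuous_const)
  refine Continuous.div ?_ ?_ ?_
  · exact (hr _).add ((hr _).mul continuous_const)
  · exact Complex.continuous_ofReal.comp
      (((continuous_const.mul (hc _)).sub continuous_const).pow 2)
  · rintro ⟨x, hx⟩
    obtain ⟨y, rfl⟩ := hE hx
    have h0 : ec y (3*n) = sgm y n := by
      have : 3 * n / 3 = n := by omega
      simp [ec, this]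
    simp only
    rw [em_val, h0]
    exact_mod_cast (pow_pos (sgm_pos y n) 2).ne'

lemma fm_cont : Continuous fm := by
  refine continuous_pi fun k => sq01_cont.comp ?_
  have := uu_cont
  split_ifs <;> fun_prop

lemma norm_uu_le (z : ℂ) : ‖uu z‖ ≤ 1 := by
  unfold uu
  rw [norm_div, Complex.norm_real, Real.norm_eq_abs, abs_of_pos (by positivity),
    div_le_one (by positivity)]
  linarith

lemma entourage_pi (V : Set ((ℕ → unitInterval) × (ℕ → unitInterval)))
    (hV : V ∈ uniformity (ℕ → unitInterval)) :
    ∃ δ > 0, ∃ K : ℕ, ∀ x y, (∀ k < K, dist (x k) (y k) < δ) → (x, y) ∈ V := by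
  rw [Pi.uniformity, Filter.mem_iInf'] at hV
  obtain ⟨F, hF, W, hW, -, hVW, -⟩ := hV
  have h : ∀ i, ∃ δ > 0, ∀ x y : ℕ → unitInterval, dist (x i) (y i) < δ → (x, y) ∈ W i := by
    intro i
    obtain ⟨t, ht, hsub⟩ := hW i
    obtain ⟨δ, hδ, h⟩ := Metric.mem_uniformity_dist.1 ht
    exact ⟨δ, hδ, fun x y hxy => hsub (h hxy)⟩
  choose δ hδ h using h
  obtain ⟨K, hK⟩ := hF.bddAbove
  obtain ⟨d, hd, hd2⟩ : ∃ d > 0, ∀ i ∈ Finset.range (K+1), d ≤ δ i :=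
    ⟨(Finset.range (K+1)).inf' (by simp) δ, by simp [hδ], fun i hi => Finset.inf'_le _ hi⟩
  refine ⟨d, hd, K+1, fun x y hxy => ?_⟩
  rw [hVW]
  refine Set.mem_iInter₂.2 fun i hi => ?_
  have hiK : i < K + 1 := Nat.lt_succ_of_le (hK hi)
  exact h i x y ((hxy i hiK).trans_le (hd2 i (Finset.mem_range.2 hiK)))

lemma bad_of_uc (E : Set (ℕ → unitInterval)) (A : Set E)
    (h : UniformContinuousOn (fun x : E => fm (ginv x.1)) A) :
    Bad {y | ∃ hy : emb0 y ∈ E, (⟨emb0 y, hy⟩ : E) ∈ A} := by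
  intro n
  let V : Set ((ℕ → unitInterval) × (ℕ → unitInterval)) :=
    {p | dist (p.1 (2*n)) (p.2 (2*n)) < 1/16} ∩ {p | dist (p.1 (2*n+1)) (p.2 (2*n+1)) < 1/16}
  have hV : V ∈ uniformity (ℕ → unitInterval) := by
    have hk : ∀ k, {p : (ℕ → unitInterval) × (ℕ → unitInterval) | dist (p.1 k) (p.2 k) < 1/16} ∈
        uniformity (ℕ → unitInterval) := fun k =>
      Pi.uniformContinuous_proj (fun _ : ℕ => unitInterval) k
        (Metric.dist_mem_uniformity (by norm_num : (0:ℝ) < 1/16))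
    exact Filter.inter_mem (hk _) (hk _)
  have h1 := h hV
  rw [Filter.mem_map, Filter.mem_inf_principal, uniformity_subtype, Filter.mem_comap] at h1
  obtain ⟨t, ht, hsub⟩ := h1
  obtain ⟨δ, hδ, K, hK⟩ := entourage_pi t ht
  refine ⟨2 * δ, by positivity, K, ?_⟩
  rintro x ⟨hx, hxA⟩ y ⟨hy, hyA⟩ hxy
  have hmem : (emb0 x, emb0 y) ∈ t := by
    apply hK
    intro k hk
    rw [emb0, emb0, sq01_dist _ _ (abs_ec_le_one _ _) (abs_ec_le_one _ _)]
    linarith [hxy k hk]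
  have h2 := @hsub (⟨emb0 x, hx⟩, ⟨emb0 y, hy⟩) hmem ⟨hxA, hyA⟩
  obtain ⟨h3, h4⟩ := h2
  simp only [Set.mem_ofPred_eq, ginv_em] at h3 h4
  have e1 : 2 * n / 2 = n := by omega
  have e2 : 2 * n % 2 = 0 := by omega
  have e3 : (2 * n + 1) / 2 = n := by omega
  have e4 : ¬ (2 * n + 1) % 2 = 0 := by omega
  simp only [fm, e1, e2, e3, if_neg e4, if_true] at h3 h4
  have hre : ∀ z, |(uu z).re| ≤ 1 := fun z => (Complex.abs_re_le_norm _).trans (norm_uu_le z)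
  have him : ∀ z, |(uu z).im| ≤ 1 := fun z => (Complex.abs_im_le_norm _).trans (norm_uu_le z)
  rw [sq01_dist _ _ (hre _) (hre _)] at h3
  rw [sq01_dist _ _ (him _) (him _)] at h4
  have h5 := Complex.norm_le_abs_re_add_abs_im (uu (x n) - uu (y n))
  rw [Complex.sub_re, Complex.sub_im] at h5
  linarith

theorem stmt_12
    (covM : ∀ S : Set (Set ℝ), (∀ s ∈ S, IsMeagre s) → #S < continuum →
      ⋃₀ S ≠ Set.univ) :
    ∃ E : Set (ℕ → unitInterval), #E = continuum ∧
      (∃ f : E → (ℕ → unitInterval), Continuous f ∧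
        ∀ A : Set E, #A = continuum → ¬ UniformContinuousOn f A) ∧
      ∀ g : E → ℝ, Continuous g → ∃ r : ℝ, #{x : E | g x = r} = continuum := by
  classical
  let I : Type := {σ : ℕ → ℕ → ℂ // Bad (closure (Set.range σ))}
  let P : Type := (ℕ → ℕ → ℂ) × (ℕ → ℝ)
  have hY : #(ℕ → ℂ) = continuum := by simp [Cardinal.mk_complex]
  have hYY : #(ℕ → ℕ → ℂ) = continuum := by simp [Cardinal.mk_complex]
  have hI : #I ≤ continuum := (mk_subtype_le _).trans hYY.le
  have hP : #P ≤ continuum := by simp [P, Cardinal.mk_complex, Cardinal.mk_real]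
  let B : I → Set (ℕ → ℂ) := fun i => closure (Set.range i.1)
  have hB : ∀ i, Bad (B i) := fun i => i.2
  have hsing : ∀ y, ∃ i, y ∈ B i := by
    intro y
    refine ⟨⟨fun _ => y, Bad.closure ?_⟩, subset_closure ⟨0, rfl⟩⟩
    intro n
    refine ⟨1, one_pos, 0, ?_⟩
    rintro _ ⟨_, rfl⟩ _ ⟨_, rfl⟩ -
    simp
  let φ : P → (ℕ → ℂ) → ℝ := fun p => Function.extend p.1 p.2 0
  let D : P → Set (ℕ → ℂ) := fun p =>
    {x | x ∈ closure (Set.range p.1) ∧ ∃ r, Tendsto (φ p) (𝓝[Set.range p.1] x) (𝓝 r)}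
  have hcont : ∀ p, ContinuousOn (extendFrom (Set.range p.1) (φ p)) (D p) := fun p =>
    continuousOn_extendFrom (fun x hx => hx.1) (fun x hx => hx.2)
  have hbig := fun p => big_fibre covM B hB (D p) _ (hcont p)
  choose Z hZ hZ2 using hbig
  obtain ⟨Y0, hY0Z, hY0B⟩ := transfinite_pick hI hP B hsing Z hZ
  have heminj : Function.Injective emb0 := Function.LeftInverse.injective ginv_em
  have hEsub : emb0 '' Y0 ⊆ Set.range emb0 := Set.image_subset_range _ _
  have hEle : #(emb0 '' Y0) ≤ continuum := mk_image_le.trans ((mk_set_le _).trans hY.le)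
  have hY0c : continuum ≤ #Y0 :=
    (hY0Z (fun _ => 0, fun _ => 0)).trans (mk_le_mk_of_subset Set.inter_subset_left)
  refine ⟨emb0 '' Y0, ?_, ⟨fun x => fm (ginv x.1), ?_, ?_⟩, ?_⟩
  · refine le_antisymm hEle ?_
    rwa [mk_image_eq heminj]
  · exact fm_cont.comp (ginv_cont _ hEsub)
  · intro A hA huc
    have hbad := bad_of_uc _ A huc
    set A' := {y | ∃ hy : emb0 y ∈ emb0 '' Y0, (⟨emb0 y, hy⟩ : (emb0 '' Y0 : Set _)) ∈ A} with hA'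
    have hA'Y : A' ⊆ Y0 := by
      rintro y ⟨hy, -⟩
      exact (heminj.mem_set_image).1 hy
    have hcard : continuum ≤ #A' := by
      rw [← hA]
      refine mk_le_of_injective (f := fun x : A => (⟨ginv x.1.1, ?_⟩ : A')) ?_
      · obtain ⟨⟨_, y, hy, rfl⟩, hx⟩ := x
        simp only [ginv_em]
        exact ⟨⟨y, hy, rfl⟩, hx⟩
      · rintro ⟨⟨_, y, hy, rfl⟩, hx⟩ ⟨⟨_, y', hy', rfl⟩, hx'⟩ h
        simp only [Subtype.mk.injEq, ginv_em] at h
        subst h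
        rfl
    have hne : A'.Nonempty := by
      rw [← Set.nonempty_coe_sort, ← mk_ne_zero_iff]
      exact (continuum_pos.trans_le hcard).ne'
    obtain ⟨σ, h1, h2⟩ := exists_seq A' hne
    have := hY0B ⟨σ, (hbad.mono h1).closure⟩
    refine absurd (hcard.trans (mk_le_mk_of_subset ?_)) (not_le.2 this)
    exact fun y hy => ⟨hA'Y hy, h2 hy⟩
  · intro g hg
    have hne : Y0.Nonempty := by
      rw [← Set.nonempty_coe_sort, ← mk_ne_zero_iff]
      exact (continuum_pos.trans_le hY0c).ne'
    obtain ⟨σ, h1, h2⟩ := exists_seq Y0 hne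
    let g' : (ℕ → ℂ) → ℝ := fun y => if hy : y ∈ Y0 then g ⟨emb0 y, y, hy, rfl⟩ else 0
    have hg' : ContinuousOn g' Y0 := by
      rw [continuousOn_iff_continuous_restrict]
      have : Y0.domRestrict g' = fun y : Y0 => g ⟨emb0 y.1, y.1, y.2, rfl⟩ := by
        funext y; exact dif_pos y.2
      rw [this]
      exact hg.comp (Continuous.subtype_mk (em_cont.comp continuous_subtype_val) _)
    let p : P := (σ, g' ∘ σ)
    have hφ : ∀ y ∈ Set.range σ, φ p y = g' y := by
      rintro _ ⟨n, rfl⟩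
      have hf : Function.FactorsThrough (g' ∘ σ) σ := fun a b hab => by
        simp only [Function.comp, hab]
      exact hf.extend_apply 0 n
    have hlim : ∀ y ∈ Y0, Tendsto (φ p) (𝓝[Set.range σ] y) (𝓝 (g' y)) := by
      intro y hy
      have h3 : Tendsto g' (𝓝[Set.range σ] y) (𝓝 (g' y)) := (hg' y hy).mono_left (nhdsWithin_mono _ h1)
      refine h3.congr' ?_
      filter_upwards [self_mem_nhdsWithin] with z hz using (hφ z hz).symm
    have hYD : Y0 ⊆ D p := fun y hy => ⟨h2 hy, _, hlim y hy⟩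
    have hext : ∀ y ∈ Y0, extendFrom (Set.range σ) (φ p) y = g' y := fun y hy =>
      extendFrom_eq (h2 hy) (hlim y hy)
    rcases hZ2 p with hZp | ⟨r, hZp⟩
    · exfalso
      have h3 := hY0Z p
      have h4 : Y0 ∩ Z p = ∅ := by
        rw [hZp]
        ext y
        simp only [Set.mem_inter_iff, Set.mem_compl_iff, Set.mem_empty_iff_false, iff_false, not_and,
          not_not]
        exact fun hy => hYD hy
      rw [h4] at h3
      rw [mk_emptyCollection] at h3
      exact absurd h3 (not_le.2 continuum_pos)
    · refine ⟨r, le_antisymm ((mk_set_le _).trans hEle) ((hY0Z p).trans ?_)⟩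
      refine mk_le_of_injective (f := fun y : (Y0 ∩ Z p : Set _) =>
        (⟨⟨emb0 y.1, y.1, y.2.1, rfl⟩, ?_⟩ : {x : (emb0 '' Y0 : Set _) | g x = r})) ?_
      · have hy := hZp.subset y.2.2
        have h3 := hy.2
        rw [show p.1 = σ from rfl, hext y.1 y.2.1] at h3
        have h4 : g' y.1 = g ⟨emb0 y.1, y.1, y.2.1, rfl⟩ := dif_pos y.2.1
        rw [h4] at h3
        exact h3
      · intro y y' h
        simp only [Subtype.mk.injEq] at h
        exact Subtype.ext (heminj (congrArg Subtype.val h))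
end
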